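/- arXiv:1805.09685 — 2 statements merged into one kernel-verified Lean document; each statement's English description precedes it below -/
import Mathlib

section
/- Let M̂ = (p! M_p)_{p∈ℕ} be a sequence with M̂ ∈ LC, γ(ω_{M̂}) > 1, and M̂ of moderate growth: ∃C ≥ 1 ∀j,k ∈ ℕ: M̂_{j+k} ≤ C^{j+k} M̂_j M̂_k. Then for every γ with 0 < γ < min(2, γ(ω_{M̂}) − 1), the Borel map on the Beurling class is surjective: for every complex sequence λ such that sup_p |λ_p|/(h^p M̂_p) < ∞ for every h > 0, there exists f holomorphic on S_γ with sup_{z∈S_γ, p∈ℕ} |f^{(p)}(z)|/(h^p M̂_p) < ∞ for every h > 0 and such that for every p ∈ ℕ, f^{(p)}(z) → λ_p as z → 0 within S_γ. -/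
open Filter MeasureTheory Set Asymptotics

noncomputable section

/-- A *weight function*: continuous and nondecreasing on `[0,∞)`, vanishing at `0`,
and tending to `+∞` at `+∞`. -/
structure IsWeightFunction (ω : ℝ → ℝ) : Prop where
  continuousOn : ContinuousOn ω (Set.Ici 0)
  monotoneOn : MonotoneOn ω (Set.Ici 0)
  map_zero : ω 0 = 0
  tendsto_atTop : Filter.Tendsto ω Filter.atTop Filter.atTop

/-- Condition `(P_{ω,γ})`: there is `K > 1` with `limsup_{t→∞} ω(K^γ t)/ω(t) < K`,
expressed through an eventual bound by some `c < K`. -/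
def Pcond (ω : ℝ → ℝ) (γ : ℝ) : Prop :=
  ∃ K : ℝ, 1 < K ∧ ∃ c : ℝ, c < K ∧ ∀ᶠ t : ℝ in Filter.atTop, ω (K ^ γ * t) / ω t ≤ c

/-- The growth index `γ(ω) ∈ [0,+∞]`, with `sup ∅ = 0`. -/
noncomputable def gammaIndex (ω : ℝ → ℝ) : ENNReal :=
  ⨆ γ ∈ {γ : ℝ | 0 < γ ∧ Pcond ω γ}, ENNReal.ofReal γ

/-- Condition `(ω₁)`. -/
def Omega1 (ω : ℝ → ℝ) : Prop :=
  ∃ L : ℝ, 1 ≤ L ∧ ∀ t : ℝ, 0 ≤ t → ω (2 * t) ≤ L * (ω t + 1)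

/-- Condition `(ω₃)`: `log t = o(ω t)` as `t → ∞`. -/
def Omega3 (ω : ℝ → ℝ) : Prop :=
  (fun t : ℝ => Real.log t) =o[Filter.atTop] ω

/-- Condition `(ω₄)`: `t ↦ ω (exp t)` is convex on `ℝ`. -/
def Omega4 (ω : ℝ → ℝ) : Prop :=
  ConvexOn ℝ Set.univ (fun t : ℝ => ω (Real.exp t))

/-- Condition `(ω₅)`: `ω t = o(t)` as `t → ∞`. -/
def Omega5 (ω : ℝ → ℝ) : Prop :=
  ω =o[Filter.atTop] (fun t : ℝ => t)

/-- Condition `(ω_snq)`. -/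
def OmegaSnq (ω : ℝ → ℝ) : Prop :=
  ∃ C : ℝ, 0 < C ∧ ∀ y : ℝ, 0 < y →
    (∫⁻ t in Set.Ioi (1:ℝ), ENNReal.ofReal (ω (y * t) / t ^ 2)) ≤
      ENNReal.ofReal (C * (ω y + 1))

/-- `ω ∈ W₀`: normalized weight function with `(ω₃)` and `(ω₄)`. -/
def InW0 (ω : ℝ → ℝ) : Prop :=
  IsWeightFunction ω ∧ (∀ t ∈ Set.Icc (0:ℝ) 1, ω t = 0) ∧ Omega3 ω ∧ Omega4 ω

/-- The Legendre–Fenchel–Young conjugate `φ*_ω(x) = sup {x y − ω(e^y) : y ≥ 0}`. -/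
noncomputable def phiStar (ω : ℝ → ℝ) (x : ℝ) : ℝ :=
  sSup ((fun y : ℝ => x * y - ω (Real.exp y)) '' Set.Ici 0)

/-- The associated weight matrix `W^l_j = exp((1/l) φ*_ω(l j))`. -/
noncomputable def Wseq (ω : ℝ → ℝ) (l : ℝ) (j : ℕ) : ℝ :=
  Real.exp ((1 / l) * phiStar ω (l * (j : ℝ)))

/-- `w^l_j = W^l_j / j!`. -/
noncomputable def wseq (ω : ℝ → ℝ) (l : ℝ) (j : ℕ) : ℝ :=
  Wseq ω l j / (Nat.factorial j : ℝ)

/-- `h_M(t) = inf_{k ∈ ℕ} M_k t^k`. -/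
noncomputable def hFun (M : ℕ → ℝ) (t : ℝ) : ℝ :=
  ⨅ k : ℕ, M k * t ^ k

/-- The associated function `ω_M(t) = sup_p log (t^p / M_p)` for `t > 0`, `ω_M(0) = 0`. -/
noncomputable def assocWeight (M : ℕ → ℝ) (t : ℝ) : ℝ :=
  if t ≤ 0 then 0 else ⨆ p : ℕ, Real.log (t ^ p / M p)

/-- The upper Legendre conjugate `ω⋆(s) = sup_{t ≥ 0} (ω(t) − s t)`. -/
noncomputable def upperConj (ω : ℝ → ℝ) (s : ℝ) : ℝ :=
  sSup ((fun t : ℝ => ω t - s * t) '' Set.Ici 0)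

/-- `(ω⋆)^ι(t) = ω⋆(1/t)` for `t > 0`, with value `0` at `t = 0`. -/
noncomputable def upperConjIota (ω : ℝ → ℝ) (t : ℝ) : ℝ :=
  if t = 0 then 0 else upperConj ω (1 / t)

/-- The lower Legendre conjugate `(ω^ι)_⋆(t) = inf_{s > 0} (ω(1/s) + t s)`. -/
noncomputable def lowerConjIota (ω : ℝ → ℝ) (t : ℝ) : ℝ :=
  sInf ((fun s : ℝ => ω (1 / s) + t * s) '' Set.Ioi 0)

/-- The unbounded sector `S_γ ⊆ ℂ` of opening `γ π` bisected by direction `0`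
(for `0 < γ < 2` it lies in `ℂ`). -/
def sector (γ : ℝ) : Set ℂ :=
  {z : ℂ | z ≠ 0 ∧ |Complex.arg z| < γ * Real.pi / 2}

/-- `M ∈ LC`: positive, normalized, log-convex, `(M_p)^{1/p} → ∞`. -/
def LCseq (M : ℕ → ℝ) : Prop :=
  (∀ p, 0 < M p) ∧ M 0 = 1 ∧ M 0 ≤ M 1 ∧
  (∀ j : ℕ, 1 ≤ j → M j ^ 2 ≤ M (j - 1) * M (j + 1)) ∧
  Filter.Tendsto (fun p : ℕ => M p ^ ((1 : ℝ) / (p : ℝ))) Filter.atTop Filter.atTop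

/-- The partial derivative `∂_i` of a function on `ℝ^d`. -/
noncomputable def partialDeriv {d : ℕ} (i : Fin d)
    (f : EuclideanSpace ℝ (Fin d) → ℂ) : EuclideanSpace ℝ (Fin d) → ℂ :=
  fun x => fderiv ℝ f x (EuclideanSpace.single i 1)

/-- The iterated partial derivative `∂^j` for a multiindex `j ∈ ℕ^d`. -/
noncomputable def multiDeriv {d : ℕ} (j : Fin d → ℕ)
    (f : EuclideanSpace ℝ (Fin d) → ℂ) : EuclideanSpace ℝ (Fin d) → ℂ :=
  (List.finRange d).foldr (fun i g => (partialDeriv i)^[j i] g) f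

end

lemma norm_log_one_add_le_two_mul {y : ℂ} (hy : 0 ≤ y.re) :
    ‖Complex.log (1 + y)‖ ≤ 2 * Real.log (1 + ‖y‖) := by
  have hslit : ∀ s : ℝ, 0 ≤ s → 1 + (s : ℂ) * y ∈ Complex.slitPlane := fun s hs => by
    left
    simp only [Complex.add_re, Complex.one_re, Complex.mul_re, Complex.ofReal_re,
      Complex.ofReal_im, zero_mul, sub_zero]
    positivity
  have hderiv : ∀ s : ℝ, 0 ≤ s →
      HasDerivAt (fun s : ℝ => Complex.log (1 + (s : ℂ) * y)) (y / (1 + (s : ℂ) * y)) s := by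
    intro s hs
    have h1 : HasDerivAt (fun s : ℝ => 1 + (s : ℂ) * y) y s := by
      simpa using ((Complex.ofRealCLM.hasDerivAt (x := s)).mul_const y).const_add 1
    exact h1.clog_real (hslit s hs)
  have hB : ∀ s : ℝ, 0 ≤ s →
      HasDerivAt (fun s : ℝ => 2 * Real.log (1 + s * ‖y‖)) (2 * (‖y‖ / (1 + s * ‖y‖))) s := by
    intro s hs
    have h1 : HasDerivAt (fun s : ℝ => 1 + s * ‖y‖) ‖y‖ s := by
      simpa using ((hasDerivAt_id s).mul_const ‖y‖).const_add 1
    exact (h1.log (by positivity)).const_mul 2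
  have key := image_norm_le_of_norm_deriv_right_le_deriv_boundary' (a := 0) (b := 1)
    (f := fun s : ℝ => Complex.log (1 + (s : ℂ) * y)) (f' := fun s => y / (1 + (s : ℂ) * y))
    (B := fun s : ℝ => 2 * Real.log (1 + s * ‖y‖)) (B' := fun s => 2 * (‖y‖ / (1 + s * ‖y‖)))
    (fun s hs => (hderiv s hs.1).continuousAt.continuousWithinAt)
    (fun s hs => (hderiv s hs.1).hasDerivWithinAt) (by simp)
    (fun s hs => (hB s hs.1).continuousAt.continuousWithinAt)
    (fun s hs => (hB s hs.1).hasDerivWithinAt) ?_ (x := 1) (by simp)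
  · simpa using key
  · rintro s ⟨hs, -⟩
    have hpos : (0 : ℝ) < ‖1 + (s : ℂ) * y‖ :=
      norm_pos_iff.2 (Complex.slitPlane_ne_zero (hslit s hs))
    have hsq : (1 + s * ‖y‖) ^ 2 ≤ (2 * ‖1 + (s : ℂ) * y‖) ^ 2 := by
      rw [mul_pow, Complex.sq_norm, Complex.normSq_apply]
      have hy2 : ‖y‖ ^ 2 = y.re * y.re + y.im * y.im := by
        rw [Complex.sq_norm, Complex.normSq_apply]
      simp only [Complex.add_re, Complex.one_re, Complex.mul_re, Complex.ofReal_re,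
        Complex.ofReal_im, zero_mul, sub_zero, Complex.add_im, Complex.one_im, Complex.mul_im,
        add_zero, zero_add]
      have hsy : (s * ‖y‖) ^ 2 = s * y.re * (s * y.re) + s * y.im * (s * y.im) := by
        rw [mul_pow, hy2]; ring
      nlinarith [mul_nonneg hs hy, sq_nonneg (1 - s * ‖y‖), sq_nonneg (s * ‖y‖)]
    have hle := abs_le_of_sq_le_sq' hsq (by positivity)
    rw [norm_div, ← mul_div_assoc, div_le_div_iff₀ hpos (by positivity)]
    nlinarith [norm_nonneg y, hle.2]

lemma mul_log_one_add_norm_le_re {y : ℂ} {c : ℝ} (hc : 0 ≤ c) (hc1 : c ≤ 1)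
    (hy : c * ‖y‖ ≤ y.re) :
    c * Real.log (1 + ‖y‖) ≤ (Complex.log (1 + y)).re := by
  have hy2 : ‖y‖ ^ 2 = y.re * y.re + y.im * y.im := by
    rw [Complex.sq_norm, Complex.normSq_apply]
  have hre : 0 ≤ y.re := le_trans (by positivity) hy
  have h1 : c * (1 + ‖y‖) ^ 2 + (1 - c) * 1 ≤ ‖1 + y‖ ^ 2 := by
    rw [Complex.sq_norm, Complex.normSq_apply]
    simp only [Complex.add_re, Complex.one_re, Complex.add_im, Complex.one_im, zero_add]
    nlinarith [sq_nonneg ‖y‖]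
  have h2 := Real.geom_mean_le_arith_mean2_weighted hc (sub_nonneg.2 hc1)
    (sq_nonneg (1 + ‖y‖)) zero_le_one (by ring)
  rw [Real.one_rpow, mul_one] at h2
  have h3 := Real.log_le_log (by positivity) (h2.trans h1)
  rw [Real.log_rpow (by positivity), Real.log_pow, Real.log_pow] at h3
  rw [Complex.log_re]
  push_cast at h3
  linarith

/-- `1 - e^{-w} ∑_{j<k} w^j / j!`: it vanishes to order `k` at `0` and is exponentially close to `1`
far out in the right half-plane. -/
noncomputable def expCutoff (k : ℕ) (w : ℂ) : ℂ :=
  1 - Complex.exp (-w) * ∑ j ∈ Finset.range k, w ^ j / (j.factorial : ℂ)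

lemma differentiable_expCutoff (k : ℕ) : Differentiable ℂ (expCutoff k) := by
  unfold expCutoff
  fun_prop

lemma exp_sub_sum_le_pow_mul_exp {x l : ℝ} (hx : 0 ≤ x) (hl : 1 ≤ l) (k : ℕ) :
    l ^ k * (Real.exp x - ∑ m ∈ Finset.range k, x ^ m / (m.factorial : ℝ)) ≤ Real.exp (l * x) := by
  have hs : ∀ y : ℝ, Summable fun m : ℕ => y ^ m / (m.factorial : ℝ) :=
    Real.summable_pow_div_factorial
  have he : ∀ y : ℝ, ∑' m : ℕ, y ^ m / (m.factorial : ℝ) = Real.exp y := fun y => by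
    rw [Real.exp_eq_exp_ℝ, NormedSpace.exp_eq_tsum_div]
  have h1 := (hs x).sum_add_tsum_nat_add k
  have h2 := (hs (l * x)).sum_add_tsum_nat_add k
  rw [he] at h1 h2
  have h3 : 0 ≤ ∑ m ∈ Finset.range k, (l * x) ^ m / (m.factorial : ℝ) :=
    Finset.sum_nonneg fun _ _ => by positivity
  have h4 : l ^ k * ∑' m, x ^ (m + k) / ((m + k).factorial : ℝ) ≤
      ∑' m, (l * x) ^ (m + k) / ((m + k).factorial : ℝ) := by
    rw [← tsum_mul_left]
    refine Summable.tsum_le_tsum (fun m => ?_)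
      (((summable_nat_add_iff k).2 (hs x)).mul_left _) ((summable_nat_add_iff k).2 (hs (l * x)))
    rw [mul_pow, mul_div_assoc]
    gcongr
    exact Nat.le_add_left k m
  rw [← h1, ← h2]
  linarith

lemma norm_expCutoff_le {w : ℂ} {l : ℝ} (hw : 0 ≤ w.re) (hl : 1 ≤ l) (k : ℕ) :
    ‖expCutoff k w‖ ≤ l⁻¹ ^ k * Real.exp (l * ‖w‖) := by
  have h : expCutoff k w = Complex.exp (-w) *
      (Complex.exp w - ∑ j ∈ Finset.range k, w ^ j / (j.factorial : ℂ)) := by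
    rw [expCutoff, mul_sub, ← Complex.exp_add, neg_add_cancel, Complex.exp_zero]
  have h1 : ‖Complex.exp (-w)‖ ≤ 1 := by
    rw [Complex.norm_exp]
    exact Real.exp_le_one_iff.2 (by simpa using hw)
  have h2 := Complex.norm_exp_sub_sum_le_exp_norm_sub_sum w k
  have h3 := exp_sub_sum_le_pow_mul_exp (norm_nonneg w) hl k
  rw [h, norm_mul, inv_pow, inv_mul_eq_div, le_div_iff₀ (by positivity)]
  calc _ ≤ 1 * (Real.exp ‖w‖ - ∑ m ∈ Finset.range k, ‖w‖ ^ m / (m.factorial : ℝ)) * l ^ k := by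
        gcongr
    _ ≤ _ := by linarith

lemma norm_one_sub_expCutoff_le {w : ℂ} {c κ : ℝ} (hc : 0 < c) (hc1 : c ≤ 1)
    (hre : c * κ ≤ w.re) (hnorm : ‖w‖ ≤ 2 * κ) (k : ℕ) :
    ‖1 - expCutoff k w‖ ≤ (4 / c) ^ k * Real.exp (-(c / 2 * κ)) := by
  have hκ : 0 ≤ κ := by linarith [norm_nonneg w]
  have h1 : ‖∑ j ∈ Finset.range k, w ^ j / (j.factorial : ℂ)‖ ≤
      (4 / c) ^ k * Real.exp (c / 2 * κ) := by
    refine (norm_sum_le _ _).trans ?_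
    calc ∑ j ∈ Finset.range k, ‖w ^ j / (j.factorial : ℂ)‖
        ≤ ∑ j ∈ Finset.range k, (4 / c) ^ k * ((c / 2 * κ) ^ j / (j.factorial : ℝ)) := by
          refine Finset.sum_le_sum fun j hj => ?_
          rw [norm_div, norm_pow, Complex.norm_natCast, ← mul_div_assoc]
          gcongr
          calc ‖w‖ ^ j ≤ (4 / c * (c / 2 * κ)) ^ j := by
                gcongr
                refine hnorm.trans (le_of_eq ?_)
                field_simp
                ring
            _ ≤ _ := by
                rw [mul_pow]
                gcongr
                · rw [le_div_iff₀ hc]; linarith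
                · exact (Finset.mem_range.1 hj).le
      _ ≤ _ := by
          rw [← Finset.mul_sum]
          gcongr
          exact Real.sum_le_exp_of_nonneg (by positivity) k
  rw [expCutoff, sub_sub_cancel, norm_mul, Complex.norm_exp, Complex.neg_re]
  calc _ ≤ Real.exp (-(c * κ)) * ((4 / c) ^ k * Real.exp (c / 2 * κ)) := by gcongr
    _ = _ := by
      rw [mul_left_comm, ← Real.exp_add]
      ring_nf

lemma log_one_add_le_rpow_div {y τ : ℝ} (hy : 0 ≤ y) (hτ : 0 < τ) (hτ1 : τ ≤ 1) :
    Real.log (1 + y) ≤ y ^ τ / τ := by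
  have h1 : (1 + y) ^ τ ≤ 1 + y ^ τ := by
    simpa using Real.rpow_add_le_add_rpow zero_le_one hy hτ.le hτ1
  have h2 := Real.log_le_log (by positivity) h1
  have h3 := Real.log_le_sub_one_of_pos (x := 1 + y ^ τ) (by positivity)
  rw [Real.log_rpow (by positivity)] at h2
  rw [le_div_iff₀ hτ]
  linarith

lemma sum_inv_sqrt_le (p : ℕ) :
    ∑ q ∈ Finset.range p, (1 : ℝ) / √((q : ℝ) + 1) ≤ 2 * √(p : ℝ) := by
  induction p with
  | zero => simp
  | succ p ih =>
    rw [Finset.sum_range_succ]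
    push_cast
    have hb : 0 < √((p : ℝ) + 1) := Real.sqrt_pos.2 (by positivity)
    have h1 : √((p : ℝ) + 1) ^ 2 = p + 1 := Real.sq_sqrt (by positivity)
    have h2 : √(p : ℝ) ^ 2 = p := Real.sq_sqrt (by positivity)
    have h3 : 1 / √((p : ℝ) + 1) ≤ 2 * √((p : ℝ) + 1) - 2 * √(p : ℝ) := by
      rw [div_le_iff₀ hb]
      nlinarith [sq_nonneg (√((p : ℝ) + 1) - √(p : ℝ))]
    linarith

lemma sum_sqrt_div_le (p : ℕ) :
    ∑ q ∈ Finset.range p, ((p : ℝ) / (q + 1)) ^ (1 / 2 : ℝ) ≤ 2 * p := by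
  calc _ = √(p : ℝ) * ∑ q ∈ Finset.range p, (1 : ℝ) / √((q : ℝ) + 1) := by
        rw [Finset.mul_sum]
        refine Finset.sum_congr rfl fun q _ => ?_
        rw [← Real.sqrt_eq_rpow, Real.sqrt_div (by positivity), mul_one_div]
    _ ≤ √(p : ℝ) * (2 * √(p : ℝ)) := by gcongr; exact sum_inv_sqrt_le p
    _ = 2 * p := by
        rw [mul_left_comm, Real.mul_self_sqrt (by positivity)]

lemma rpow_neg_le_sub {x σ : ℝ} (hx : 0 < x) (hσ : 1 < σ) :
    (σ - 1) * (x + 1) ^ (-σ) ≤ x ^ (1 - σ) - (x + 1) ^ (1 - σ) := by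
  have h1 : x ^ (1 - σ) = (x + 1) ^ (1 - σ) * (x / (x + 1)) ^ (1 - σ) := by
    rw [← Real.mul_rpow (by positivity) (by positivity)]
    congr 1
    field_simp
  have h2 : 1 + (σ - 1) / (x + 1) ≤ (x / (x + 1)) ^ (1 - σ) := by
    rw [Real.rpow_def_of_pos (by positivity)]
    have h3 := Real.log_le_sub_one_of_pos (x := x / (x + 1)) (by positivity)
    have h4 : x / (x + 1) - 1 = -(1 / (x + 1)) := by field_simp; ring
    have h5 := Real.add_one_le_exp (Real.log (x / (x + 1)) * (1 - σ))
    have h6 : (σ - 1) / (x + 1) ≤ Real.log (x / (x + 1)) * (1 - σ) := by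
      rw [h4] at h3
      rw [div_eq_mul_one_div]
      nlinarith
    linarith
  have h7 : (x + 1) ^ (-σ) = (x + 1) ^ (1 - σ) / (x + 1) := by
    rw [eq_div_iff (by positivity), ← Real.rpow_add_one (by positivity)]
    congr 1
    ring
  rw [h1, h7]
  have h8 : 0 < (x + 1) ^ (1 - σ) := by positivity
  calc _ = (x + 1) ^ (1 - σ) * ((σ - 1) / (x + 1)) := by ring
    _ ≤ (x + 1) ^ (1 - σ) * ((x / (x + 1)) ^ (1 - σ) - 1) := by gcongr; linarith
    _ = _ := by ring

lemma sum_rpow_div_le {p : ℕ} (hp : 1 ≤ p) {σ : ℝ} (hσ : 1 < σ) (m : ℕ) :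
    ∑ q ∈ Finset.range m, ((p : ℝ) / ((q + p : ℕ) + 1)) ^ σ ≤ p / (σ - 1) := by
  have hp0 : (0 : ℝ) < p := by exact_mod_cast hp
  have key : ∑ q ∈ Finset.range m, (σ - 1) * (((q + p : ℕ) : ℝ) + 1) ^ (-σ) ≤
      (p : ℝ) ^ (1 - σ) - ((m + p : ℕ) : ℝ) ^ (1 - σ) := by
    induction m with
    | zero => simp
    | succ m ih =>
      rw [Finset.sum_range_succ]
      have h := rpow_neg_le_sub (x := ((m + p : ℕ) : ℝ)) (by positivity) hσ
      have h' : ((m + 1 + p : ℕ) : ℝ) = ((m + p : ℕ) : ℝ) + 1 := by push_cast; ring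
      rw [h']
      linarith
  have h0 : 0 ≤ ((m + p : ℕ) : ℝ) ^ (1 - σ) := by positivity
  rw [le_div_iff₀ (by linarith)]
  calc _ = (p : ℝ) ^ σ * ∑ q ∈ Finset.range m, (σ - 1) * (((q + p : ℕ) : ℝ) + 1) ^ (-σ) := by
        rw [Finset.mul_sum, Finset.sum_mul]
        refine Finset.sum_congr rfl fun q _ => ?_
        rw [Real.div_rpow (by positivity) (by positivity), Real.rpow_neg (by positivity)]
        ring
    _ ≤ (p : ℝ) ^ σ * (p : ℝ) ^ (1 - σ) := by gcongr; linarith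
    _ = p := by rw [← Real.rpow_add hp0]; simp

/-- The sequence `ν` grows at least like the power `β` and at most like the power `B`. -/
structure PowerGrowth (ν : ℕ → ℝ) (c β D : ℝ) (B : ℕ) : Prop where
  pos : ∀ q, 0 < ν q
  c_pos : 0 < c
  c_le_one : c ≤ 1
  lower : ∀ q p : ℕ, q ≤ p → c * (((p : ℝ) + 1) / (q + 1)) ^ β * ν q ≤ ν p
  upper : ∀ q p : ℕ, q ≤ p → ν p ≤ D * (((p : ℝ) + 1) / (q + 1)) ^ B * ν q

/-- The logarithm of the product `∏ (1 + (t / ν q) ^ b)`. -/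
noncomputable def logProd (ν : ℕ → ℝ) (b t : ℝ) : ℝ :=
  ∑' q, Real.log (1 + (t / ν q) ^ b)

namespace PowerGrowth

variable {ν : ℕ → ℝ} {c β D : ℝ} {B : ℕ}

lemma D_pos (h : PowerGrowth ν c β D B) : 0 < D := by
  have h1 := h.upper 0 0 le_rfl
  have h2 := h.pos 0
  by_contra hD
  norm_num at h1 hD
  nlinarith

lemma mul_le (h : PowerGrowth ν c β D B) (hβ : 0 ≤ β) {q p : ℕ} (hqp : q ≤ p) :
    c * ν q ≤ ν p := by
  refine le_trans ?_ (h.lower q p hqp)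
  have h1 : (1 : ℝ) ≤ (((p : ℝ) + 1) / (q + 1)) ^ β := by
    refine Real.one_le_rpow ?_ hβ
    rw [le_div_iff₀ (by positivity)]
    have : (q : ℝ) ≤ p := by exact_mod_cast hqp
    linarith
  have := h.c_pos
  have := h.pos q
  nlinarith [mul_pos ‹0 < c› ‹0 < ν q›]

lemma div_rpow_le (h : PowerGrowth ν c β D B) {b t : ℝ} (hb : 0 < b) (ht : 0 < t) {q p : ℕ}
    (hqp : q ≤ p) :
    (t / ν p) ^ b ≤ (t / ν q) ^ b * c⁻¹ ^ b * (((q : ℝ) + 1) / (p + 1)) ^ (b * β) := by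
  have hc := h.c_pos
  have hq := h.pos q
  have hp := h.pos p
  have h1 : t / ν p ≤ t / ν q * c⁻¹ * (((q : ℝ) + 1) / (p + 1)) ^ β := by
    have h2 := h.lower q p hqp
    have h3 : (((q : ℝ) + 1) / (p + 1)) ^ β = ((((p : ℝ) + 1) / (q + 1)) ^ β)⁻¹ := by
      rw [← Real.inv_rpow (by positivity), inv_div]
    rw [h3]
    calc t / ν p ≤ t / (c * (((p : ℝ) + 1) / (q + 1)) ^ β * ν q) := by gcongr
      _ = _ := by field_simp
  calc (t / ν p) ^ b ≤ (t / ν q * c⁻¹ * (((q : ℝ) + 1) / (p + 1)) ^ β) ^ b := by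
        gcongr
    _ = _ := by
      rw [Real.mul_rpow (by positivity) (by positivity),
        Real.mul_rpow (by positivity) (by positivity), ← Real.rpow_mul (by positivity), mul_comm β]

lemma summable_div_rpow (h : PowerGrowth ν c β D B) {b t : ℝ} (hb : 0 < b) (hbβ : 1 < b * β)
    (ht : 0 < t) : Summable fun q => (t / ν q) ^ b := by
  have h1 : Summable fun q : ℕ => (1 : ℝ) / ((q + 1 : ℕ) : ℝ) ^ (b * β) :=
    (summable_nat_add_iff 1).2 (Real.summable_one_div_nat_rpow.2 hbβ)
  refine Summable.of_nonneg_of_le (fun q => ?_) (fun q => ?_)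
    (h1.mul_left ((t / ν 0) ^ b * c⁻¹ ^ b))
  · have := h.pos q; positivity
  · refine (h.div_rpow_le hb ht (Nat.zero_le q)).trans (le_of_eq ?_)
    rw [Nat.cast_zero, zero_add, Real.div_rpow zero_le_one (by positivity), Real.one_rpow]
    push_cast
    rfl

lemma summable_log (h : PowerGrowth ν c β D B) {b t : ℝ} (hb : 0 < b) (hbβ : 1 < b * β)
    (ht : 0 < t) : Summable fun q => Real.log (1 + (t / ν q) ^ b) := by
  have hn : ∀ q, 0 ≤ (t / ν q) ^ b := fun q => by have := h.pos q; positivity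
  refine Summable.of_nonneg_of_le (fun q => Real.log_nonneg (by linarith [hn q])) (fun q => ?_)
    (h.summable_div_rpow hb hbβ ht)
  linarith [Real.log_le_sub_one_of_pos (x := 1 + (t / ν q) ^ b) (by linarith [hn q])]

lemma exp_neg_logProd_le (h : PowerGrowth ν c β D B) {b r : ℝ} (hb : 0 < b) (hbβ : 1 < b * β)
    (hr : 0 < r) (s : Finset ℕ) :
    Real.exp (-(logProd ν b r⁻¹ / b)) ≤ ∏ q ∈ s, ν q * r := by
  have hpos : ∀ q, 0 < ν q * r := fun q => mul_pos (h.pos q) hr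
  have hr' : 0 < r⁻¹ := by positivity
  have hn : ∀ q, 0 ≤ (r⁻¹ / ν q) ^ b := fun q => by have := h.pos q; positivity
  have h1 : ∑ q ∈ s, Real.log (1 + (r⁻¹ / ν q) ^ b) ≤ logProd ν b r⁻¹ :=
    (h.summable_log hb hbβ hr').sum_le_tsum s fun q _ => Real.log_nonneg (by linarith [hn q])
  have h2 : ∑ q ∈ s, -Real.log (ν q * r) ≤ logProd ν b r⁻¹ / b := by
    rw [le_div_iff₀ hb, Finset.sum_mul]
    refine le_trans (Finset.sum_le_sum fun q _ => ?_) h1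
    have h3 : r⁻¹ / ν q = (ν q * r)⁻¹ := by rw [mul_inv, div_eq_mul_inv, mul_comm]
    have h4 : 0 < (r⁻¹ / ν q) ^ b := by rw [h3]; exact Real.rpow_pos_of_pos (inv_pos.2 (hpos q)) b
    calc -Real.log (ν q * r) * b = Real.log ((r⁻¹ / ν q) ^ b) := by
          rw [h3, Real.log_rpow (inv_pos.2 (hpos q)), Real.log_inv]; ring
      _ ≤ _ := Real.log_le_log h4 (by linarith)
  rw [← Real.exp_log (Finset.prod_pos fun q _ => hpos q),
    Real.log_prod fun q _ => (hpos q).ne']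
  refine Real.exp_le_exp.2 ?_
  rw [Finset.sum_neg_distrib] at h2
  linarith

lemma logProd_le (h : PowerGrowth ν c β D B) {b : ℝ} (hb : 0 < b) (hbβ : 1 < b * β)
    (hB : 1 ≤ 2 * B * b) :
    ∃ K : ℝ, 0 < K ∧ ∀ (p : ℕ) (s : ℝ), 0 < s → s ≤ 1 →
      logProd ν b (s * ν p) ≤ K * (p + 1) * s ^ (1 / (2 * B : ℝ)) := by
  have hD := h.D_pos
  have hc := h.c_pos
  have hB0 : (0 : ℝ) < B := by
    rcases Nat.eq_zero_or_pos B with h0 | h0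
    · norm_num [h0] at hB
    · exact_mod_cast h0
  set θ : ℝ := 1 / (2 * B) with hθ
  have hθ0 : 0 < θ := by positivity
  have hτ : θ / b ≤ 1 := by
    rw [div_le_one hb, hθ, div_le_iff₀ (by positivity)]; linarith
  have hσ : 0 < b * β - 1 := by linarith
  refine ⟨2 * D ^ θ / (θ / b) + c⁻¹ ^ b / (b * β - 1), by positivity, fun p s hs hs1 => ?_⟩
  have ht : 0 < s * ν p := mul_pos hs (h.pos p)
  have hpos := h.pos
  have hhead : ∑ q ∈ Finset.range (p + 1), Real.log (1 + (s * ν p / ν q) ^ b) ≤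
      2 * D ^ θ / (θ / b) * (p + 1) * s ^ θ := by
    calc _ ≤ ∑ q ∈ Finset.range (p + 1),
          s ^ θ * D ^ θ / (θ / b) * (((p + 1 : ℕ) : ℝ) / (q + 1)) ^ (1 / 2 : ℝ) := by
          refine Finset.sum_le_sum fun q hq => ?_
          have hqp : q ≤ p := by simpa [Nat.lt_succ_iff] using hq
          have hq0 := hpos q
          have hp0 := hpos p
          refine (log_one_add_le_rpow_div (by positivity) (by positivity) hτ).trans ?_
          rw [← Real.rpow_mul (by positivity), mul_div_cancel₀ _ hb.ne', div_mul_eq_mul_div]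
          gcongr
          have h1 : s * ν p / ν q ≤ s * D * (((p + 1 : ℕ) : ℝ) / (q + 1)) ^ B := by
            rw [div_le_iff₀ hq0]
            have := h.upper q p hqp
            push_cast
            calc _ ≤ s * (D * (((p : ℝ) + 1) / (q + 1)) ^ B * ν q) := by gcongr
              _ = _ := by ring
          calc _ ≤ (s * D * (((p + 1 : ℕ) : ℝ) / (q + 1)) ^ B) ^ θ := by gcongr
            _ = _ := by
              rw [Real.mul_rpow (by positivity) (by positivity),
                Real.mul_rpow (by positivity) (by positivity), ← Real.rpow_natCast,
                ← Real.rpow_mul (by positivity)]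
              congr 2
              rw [hθ]; field_simp
      _ ≤ s ^ θ * D ^ θ / (θ / b) * (2 * ((p + 1 : ℕ) : ℝ)) := by
          rw [← Finset.mul_sum]
          gcongr
          exact sum_sqrt_div_le (p + 1)
      _ = _ := by push_cast; ring
  have htail : ∑' q, Real.log (1 + (s * ν p / ν (q + (p + 1))) ^ b) ≤
      c⁻¹ ^ b / (b * β - 1) * (p + 1) * s ^ θ := by
    have hn : ∀ q, 0 ≤ (s * ν p / ν q) ^ b := fun q => by have := hpos q; positivity
    refine Real.tsum_le_of_sum_range_le (fun q => Real.log_nonneg (by linarith [hn (q + (p + 1))]))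
      fun m => ?_
    calc _ ≤ ∑ q ∈ Finset.range m,
          s ^ θ * c⁻¹ ^ b * (((p + 1 : ℕ) : ℝ) / ((q + (p + 1) : ℕ) + 1)) ^ (b * β) := by
          refine Finset.sum_le_sum fun q _ => ?_
          have h0 := hn (q + (p + 1))
          have h1 := Real.log_le_sub_one_of_pos (x := 1 + (s * ν p / ν (q + (p + 1))) ^ b)
            (by linarith)
          have h2 := h.div_rpow_le hb ht (q := p) (p := q + (p + 1)) (by omega)
          rw [mul_div_cancel_right₀ _ (hpos p).ne'] at h2
          have h3 : s ^ b ≤ s ^ θ := by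
            refine Real.rpow_le_rpow_of_exponent_ge hs hs1 ?_
            rw [div_le_one hb] at hτ
            exact hτ
          calc _ ≤ (s * ν p / ν (q + (p + 1))) ^ b := by linarith
            _ ≤ _ := h2
            _ ≤ _ := by push_cast; gcongr
      _ ≤ s ^ θ * c⁻¹ ^ b * (((p + 1 : ℕ) : ℝ) / (b * β - 1)) := by
          rw [← Finset.mul_sum]
          gcongr
          exact sum_rpow_div_le (by omega) hbβ m
      _ = _ := by push_cast; ring
  rw [logProd, ← (h.summable_log hb hbβ ht).sum_add_tsum_nat_add (p + 1)]
  linarith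

end PowerGrowth

/-- The holomorphic counterpart of `logProd`, as a function of `ζ` in the right half-plane. -/
noncomputable def complexLogProd (ν : ℕ → ℝ) (b : ℝ) (ζ : ℂ) : ℂ :=
  ∑' q, Complex.log (1 + ζ / ((ν q ^ b : ℝ) : ℂ))

namespace PowerGrowth

variable {ν : ℕ → ℝ} {c β D : ℝ} {B : ℕ}

lemma norm_div_rpow (h : PowerGrowth ν c β D B) {b t : ℝ} (ht : 0 < t) {ζ : ℂ}
    (hζ : ‖ζ‖ = t ^ b) (q : ℕ) : ‖ζ / ((ν q ^ b : ℝ) : ℂ)‖ = (t / ν q) ^ b := by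
  have hq := h.pos q
  rw [norm_div, hζ, Complex.norm_of_nonneg (by positivity), Real.div_rpow ht.le hq.le]

lemma norm_complexLogProd_le (h : PowerGrowth ν c β D B) {b t : ℝ} (hb : 0 < b)
    (hbβ : 1 < b * β) (ht : 0 < t) {ζ : ℂ} (hζ : ‖ζ‖ = t ^ b) (hre : 0 ≤ ζ.re) :
    ‖complexLogProd ν b ζ‖ ≤ 2 * logProd ν b t := by
  have hs := (h.summable_log hb hbβ ht).mul_left 2
  rw [logProd, ← tsum_mul_left]
  refine tsum_of_norm_bounded hs.hasSum fun q => ?_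
  have hq := h.pos q
  rw [← h.norm_div_rpow ht hζ q]
  refine norm_log_one_add_le_two_mul ?_
  rw [Complex.div_ofReal_re]
  positivity

lemma mul_logProd_le_re (h : PowerGrowth ν c β D B) {b t a : ℝ} (hb : 0 < b)
    (hbβ : 1 < b * β) (ht : 0 < t) {ζ : ℂ} (hζ : ‖ζ‖ = t ^ b) (ha : 0 ≤ a) (ha1 : a ≤ 1)
    (hre : a * ‖ζ‖ ≤ ζ.re) : a * logProd ν b t ≤ (complexLogProd ν b ζ).re := by
  have hre0 : 0 ≤ ζ.re := le_trans (by positivity) hre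
  have hs := h.summable_log hb hbβ ht
  have hsC : Summable fun q => Complex.log (1 + ζ / ((ν q ^ b : ℝ) : ℂ)) := by
    refine Summable.of_norm_bounded (hs.mul_left 2) fun q => ?_
    have hq := h.pos q
    rw [← h.norm_div_rpow ht hζ q]
    refine norm_log_one_add_le_two_mul ?_
    rw [Complex.div_ofReal_re]
    positivity
  rw [logProd, ← tsum_mul_left, complexLogProd, Complex.re_tsum hsC]
  refine Summable.tsum_le_tsum (fun q => ?_) (hs.mul_left a) (Complex.reCLM.summable hsC)
  have hq := h.pos q
  rw [← h.norm_div_rpow ht hζ q]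
  refine mul_log_one_add_norm_le_re ha ha1 ?_
  rw [Complex.div_ofReal_re, norm_div, Complex.norm_of_nonneg (by positivity), ← mul_div_assoc]
  gcongr

lemma differentiableOn_complexLogProd (h : PowerGrowth ν c β D B) {b : ℝ} (hb : 0 < b)
    (hbβ : 1 < b * β) : DifferentiableOn ℂ (complexLogProd ν b) {ζ | 0 < ζ.re} := by
  intro ζ hζ
  have hopen : IsOpen ({w : ℂ | 0 < w.re} ∩ Metric.ball 0 (‖ζ‖ + 1)) :=
    (isOpen_lt continuous_const Complex.continuous_re).inter Metric.isOpen_ball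
  have hdiff : DifferentiableOn ℂ (complexLogProd ν b)
      ({w : ℂ | 0 < w.re} ∩ Metric.ball 0 (‖ζ‖ + 1)) := by
    set R : ℝ := ‖ζ‖ + 1 with hR
    have hR0 : 0 < R := by positivity
    have hs := (h.summable_log hb hbβ (t := R ^ b⁻¹) (by positivity)).mul_left 2
    refine Complex.differentiableOn_tsum_of_summable_norm hs (fun q => ?_) hopen ?_
    · intro w hw
      have hq := h.pos q
      refine ((differentiableAt_id.div_const _).const_add 1).clog ?_
        |>.differentiableWithinAt
      left
      have hw1 : 0 < w.re := hw.1
      simp only [Complex.add_re, Complex.one_re, Complex.div_ofReal_re]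
      positivity
    · rintro q w ⟨hw, hwR⟩
      have hq := h.pos q
      have hw0 : 0 < w.re := hw
      refine (norm_log_one_add_le_two_mul ?_).trans ?_
      · rw [Complex.div_ofReal_re]; positivity
      · have h1 : ‖w / ((ν q ^ b : ℝ) : ℂ)‖ ≤ (R ^ b⁻¹ / ν q) ^ b := by
          rw [Real.div_rpow (by positivity) hq.le, ← Real.rpow_mul hR0.le,
            inv_mul_cancel₀ hb.ne', Real.rpow_one, norm_div, Complex.norm_of_nonneg (by positivity)]
          have : ‖w‖ ≤ R := by simpa using (Metric.mem_ball.1 hwR).le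
          gcongr
        gcongr
  exact ((hdiff ζ ⟨hζ, by simp⟩).differentiableAt
    (hopen.mem_nhds ⟨hζ, by simp⟩)).differentiableWithinAt

end PowerGrowth

lemma isOpen_sector {γ : ℝ} (hγ : γ ≤ 2) : IsOpen (sector γ) := by
  rw [isOpen_iff_mem_nhds]
  rintro z ⟨hz0, hz⟩
  have hpi := Real.pi_pos
  have hslit : z ∈ Complex.slitPlane := by
    rw [Complex.mem_slitPlane_iff_arg]
    refine ⟨fun h => ?_, hz0⟩
    rw [h, abs_of_pos hpi] at hz
    nlinarith
  exact (eventually_ne_nhds hz0).and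
    (((Complex.continuousAt_arg hslit).abs).eventually_lt_const hz)

lemma sector_subset_slitPlane {γ : ℝ} (hγ : γ ≤ 2) : sector γ ⊆ Complex.slitPlane := by
  rintro z ⟨hz0, hz⟩
  have hpi := Real.pi_pos
  rw [Complex.mem_slitPlane_iff_arg]
  refine ⟨fun h => ?_, hz0⟩
  rw [h, abs_of_pos hpi] at hz
  nlinarith

lemma cos_mul_norm_le_cpow_re {γ b : ℝ} (hb : 0 ≤ b) (hbγ : b * γ ≤ 2) {z : ℂ}
    (hz : z ∈ sector γ) :
    Real.cos (b * γ * Real.pi / 2) * ‖z ^ (-b : ℂ)‖ ≤ (z ^ (-b : ℂ)).re := by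
  rw [Complex.cpow_def_of_ne_zero hz.1, Complex.norm_exp, Complex.exp_re, mul_comm]
  have him : (Complex.log z * (-b : ℂ)).im = -(b * z.arg) := by
    simp [Complex.log_im, mul_comm]
  have hpi := Real.pi_pos
  rw [him, Real.cos_neg, ← Real.cos_abs (b * z.arg), abs_mul, abs_of_nonneg hb]
  refine mul_le_mul_of_nonneg_left ?_ (Real.exp_pos _).le
  have := hz.2
  refine Real.cos_le_cos_of_nonneg_of_le_pi (by positivity) ?_ ?_ <;> nlinarith

lemma norm_cpow_neg_ofReal {b : ℝ} {z : ℂ} (hz : z ≠ 0) :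
    ‖z ^ (-b : ℂ)‖ = ‖z‖⁻¹ ^ b := by
  rw [Complex.norm_cpow_of_ne_zero hz]
  simp [Real.rpow_neg, Real.inv_rpow]

namespace PowerGrowth

variable {ν : ℕ → ℝ} {c β D : ℝ} {B : ℕ}

/-- Holomorphic cutoffs on a sector adapted to the sequence `∏_{q<p} ν q`: the `p`-th one is small
far from the origin and flat-close to `1` near the origin. -/
theorem exists_cutoffs (h : PowerGrowth ν c β D B) {γ : ℝ} (hγ0 : 0 < γ) (hγ2 : γ ≤ 2)
    (hγβ : γ < β) :
    ∃ C : ℝ, 1 ≤ C ∧ ∃ χ : ℕ → ℂ → ℂ, (∀ p, DifferentiableOn ℂ (χ p) (sector γ)) ∧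
      (∀ z ∈ sector γ, ∀ n p, n ≤ p →
        ‖χ p z‖ * ∏ q ∈ Finset.Ico n p, ν q * ‖z‖ ≤ C ^ p) ∧
      (∀ z ∈ sector γ, ∀ n p, p ≤ n →
        ‖1 - χ p z‖ ≤ C ^ p * ∏ q ∈ Finset.Ico p n, ν q * ‖z‖) := by
  have hβ0 : 0 < β := hγ0.trans hγβ
  have hc := h.c_pos
  have hD := h.D_pos
  obtain ⟨b, hb1, hb2⟩ := exists_between (one_div_lt_one_div_of_lt hγ0 hγβ)
  have hb : 0 < b := lt_trans (by positivity) hb1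
  have hbβ : 1 < b * β := by rwa [div_lt_iff₀ hβ0] at hb1
  have hbγ : b * γ < 1 := by rwa [lt_div_iff₀ hγ0] at hb2
  obtain ⟨B', hB'⟩ := exists_nat_ge (1 / (2 * b))
  set E : ℕ := max (max B B') 1 with hE
  have hE1 : 1 ≤ E := le_max_right _ _
  have hE0 : (0 : ℝ) < E := by exact_mod_cast hE1
  have hEb : 1 ≤ 2 * E * b := by
    have : (B' : ℝ) ≤ E := by exact_mod_cast (le_max_right B B').trans (le_max_left _ _)
    have := hB'.trans this
    rw [div_le_iff₀ (by positivity)] at this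
    linarith
  have hEgrowth : PowerGrowth ν c β D E :=
    ⟨h.pos, h.c_pos, h.c_le_one, h.lower, fun q p hqp => (h.upper q p hqp).trans (by
      have := h.pos q
      have h1 : (1 : ℝ) ≤ ((p : ℝ) + 1) / (q + 1) := by
        rw [le_div_iff₀ (by positivity)]
        have : (q : ℝ) ≤ p := by exact_mod_cast hqp
        linarith
      gcongr
      exact (le_max_left B B').trans (le_max_left _ _))⟩
  obtain ⟨K, hK, hκ⟩ := hEgrowth.logProd_le hb hbβ hEb
  set a : ℝ := Real.cos (b * γ * Real.pi / 2) with ha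
  have hpi := Real.pi_pos
  have ha0 : 0 < a := by
    refine Real.cos_pos_of_mem_Ioo ⟨?_, ?_⟩
    · have : 0 < b * γ * Real.pi / 2 := by positivity
      linarith
    · nlinarith
  have ha1 : a ≤ 1 := Real.cos_le_one _
  set A : ℝ := 2 / (b * a) with hA
  have hA0 : 0 < A := by positivity
  set F : ℂ → ℂ := fun z => (A : ℂ) * complexLogProd ν b (z ^ (-b : ℂ)) with hF
  have hre : ∀ z ∈ sector γ, a * ‖z ^ (-b : ℂ)‖ ≤ (z ^ (-b : ℂ)).re := fun z hz =>
    cos_mul_norm_le_cpow_re hb.le (by linarith) hz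
  have hFnorm : ∀ z ∈ sector γ, ‖F z‖ ≤ 2 * (A * logProd ν b ‖z‖⁻¹) := fun z hz => by
    have hz0 : 0 < ‖z‖⁻¹ := inv_pos.2 (norm_pos_iff.2 hz.1)
    have h1 := h.norm_complexLogProd_le hb hbβ hz0 (norm_cpow_neg_ofReal (b := b) hz.1)
      (le_trans (by positivity) (hre z hz))
    rw [hF, norm_mul, Complex.norm_of_nonneg hA0.le]
    nlinarith
  have hFre : ∀ z ∈ sector γ, a * (A * logProd ν b ‖z‖⁻¹) ≤ (F z).re := fun z hz => by
    have hz0 : 0 < ‖z‖⁻¹ := inv_pos.2 (norm_pos_iff.2 hz.1)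
    have h1 := h.mul_logProd_le_re hb hbβ hz0 (norm_cpow_neg_ofReal (b := b) hz.1) ha0.le ha1
      (hre z hz)
    rw [hF, Complex.re_ofReal_mul]
    nlinarith
  have hFdiff : DifferentiableOn ℂ F (sector γ) := by
    refine ((h.differentiableOn_complexLogProd hb hbβ).comp (t := {ζ : ℂ | 0 < ζ.re}) ?_ ?_).const_mul _
    · intro z hz
      exact (differentiableAt_id.cpow_const (sector_subset_slitPlane hγ2 hz)).differentiableWithinAt
    · intro z hz
      refine lt_of_lt_of_le ?_ (hre z hz)
      have : 0 < ‖z ^ (-b : ℂ)‖ := by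
        rw [norm_cpow_neg_ofReal hz.1]
        have := norm_pos_iff.2 hz.1
        positivity
      positivity
  have hone : ∀ z ∈ sector γ, ∀ k n p : ℕ, ‖1 - expCutoff k (F z)‖ ≤
      (4 / a) ^ k * ∏ q ∈ Finset.Ico p n, ν q * ‖z‖ := fun z hz k n p => by
    refine (norm_one_sub_expCutoff_le ha0 ha1 (hFre z hz) (hFnorm z hz) k).trans ?_
    have hexp : a / 2 * (A * logProd ν b ‖z‖⁻¹) = logProd ν b ‖z‖⁻¹ / b := by
      rw [hA]; field_simp
    rw [hexp]
    gcongr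
    exact h.exp_neg_logProd_le hb hbβ (norm_pos_iff.2 hz.1) (Finset.Ico p n)
  have h4a : 1 ≤ 4 / a := by rw [le_div_iff₀ ha0]; linarith
  have hc1 : 1 ≤ c⁻¹ := (one_le_inv₀ hc).2 h.c_le_one
  set C₁ : ℝ := (4 / a) ^ (2 * E) with hC₁
  have hC₁1 : 1 ≤ C₁ := one_le_pow₀ h4a
  set C₂ : ℝ := Real.exp (2 * A * K) with hC₂
  have hC₂1 : 1 ≤ C₂ := Real.one_le_exp (by positivity)
  refine ⟨2 * C₁ * C₂ * c⁻¹, ?_, fun p z => expCutoff (2 * E * p) (F z), fun p => ?_, ?_, ?_⟩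
  · have : 1 ≤ C₁ * C₂ * c⁻¹ :=
      one_le_mul_of_one_le_of_one_le (one_le_mul_of_one_le_of_one_le hC₁1 hC₂1) hc1
    linarith
  · exact (differentiable_expCutoff _).comp_differentiableOn hFdiff
  · intro z hz n p hnp
    rcases Nat.eq_zero_or_pos p with rfl | hp
    · obtain rfl : n = 0 := by omega
      simp [expCutoff]
    have hr : 0 < ‖z‖ := norm_pos_iff.2 hz.1
    have hP := h.pos (p - 1)
    set u : ℝ := max 1 (‖z‖ * ν (p - 1)) with hu
    have hu1 : 1 ≤ u := le_max_left _ _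
    have hprod : ∏ q ∈ Finset.Ico n p, ν q * ‖z‖ ≤ (c⁻¹ * u) ^ p := by
      calc _ ≤ ∏ q ∈ Finset.Ico n p, c⁻¹ * u := by
            refine Finset.prod_le_prod (fun q _ => (mul_pos (h.pos q) hr).le) fun q hq => ?_
            have h1 := h.mul_le hβ0.le (q := q) (p := p - 1) (by
              have := (Finset.mem_Ico.1 hq).2; omega)
            have h2 : ν q ≤ c⁻¹ * ν (p - 1) := by
              rw [inv_mul_eq_div, le_div_iff₀ hc]; linarith
            calc ν q * ‖z‖ ≤ c⁻¹ * ν (p - 1) * ‖z‖ := by gcongr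
              _ = c⁻¹ * (‖z‖ * ν (p - 1)) := by ring
              _ ≤ _ := by gcongr; exact le_max_right _ _
        _ = (c⁻¹ * u) ^ (p - n) := by simp
        _ ≤ _ := pow_le_pow_right₀ (one_le_mul_of_one_le_of_one_le hc1 hu1) (by omega)
    have hχ : ‖expCutoff (2 * E * p) (F z)‖ ≤ (2 * C₁ * C₂ * u⁻¹) ^ p := by
      rcases le_or_gt (‖z‖ * ν (p - 1)) 1 with hle | hgt
      · have hu' : u = 1 := max_eq_left hle
        have h1 := hone z hz (2 * E * p) 0 0
        have h2 : expCutoff (2 * E * p) (F z) = 1 - (1 - expCutoff (2 * E * p) (F z)) := by ring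
        have h3 : ‖expCutoff (2 * E * p) (F z)‖ ≤ 1 + C₁ ^ p := by
          rw [h2]
          refine (norm_sub_le _ _).trans ?_
          rw [Finset.Ico_self, Finset.prod_empty, mul_one, pow_mul, ← hC₁] at h1
          rw [norm_one]
          linarith
        have h4 : 1 ≤ C₁ ^ p := one_le_pow₀ hC₁1
        have h5 : (2 : ℝ) ≤ 2 ^ p := by
          simpa using pow_le_pow_right₀ (one_le_two (α := ℝ)) hp
        have h6 : 1 ≤ C₂ ^ p := one_le_pow₀ hC₂1
        rw [hu', inv_one, mul_one, mul_pow, mul_pow]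
        calc _ ≤ 2 * C₁ ^ p * 1 := by linarith
          _ ≤ _ := by gcongr
      · have hu' : u = ‖z‖ * ν (p - 1) := max_eq_right hgt.le
        have hs : ‖z‖⁻¹ = u⁻¹ * ν (p - 1) := by rw [hu']; field_simp
        have hu0 : 0 < u := by linarith
        have h1 := hκ (p - 1) u⁻¹ (inv_pos.2 hu0) (inv_le_one_of_one_le₀ hu1)
        rw [← hs] at h1
        have hp1 : (((p - 1 : ℕ) : ℝ) + 1) = p := by
          rw [Nat.cast_sub hp]; simp
        rw [hp1] at h1
        set l : ℝ := u ^ (1 / (2 * E : ℝ)) with hl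
        have hl1 : 1 ≤ l := Real.one_le_rpow hu1 (by positivity)
        have hl0 : 0 < l := by linarith
        have hl2 : u⁻¹ ^ (1 / (2 * E : ℝ)) = l⁻¹ := Real.inv_rpow hu0.le _
        rw [hl2] at h1
        have hlE : l ^ (2 * E) = u := by
          rw [hl, ← Real.rpow_natCast, ← Real.rpow_mul hu0.le]
          push_cast
          rw [one_div, inv_mul_cancel₀ (by positivity), Real.rpow_one]
        have h2 : 0 ≤ (F z).re := by
          have hn := norm_nonneg (F z)
          have := hFnorm z hz
          exact le_trans (mul_nonneg ha0.le (by linarith)) (hFre z hz)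
        have h3 := norm_expCutoff_le h2 hl1 (2 * E * p)
        have h4 : l * ‖F z‖ ≤ p * (2 * A * K) := by
          calc l * ‖F z‖ ≤ l * (2 * (A * (K * p * l⁻¹))) := by
                gcongr
                exact (hFnorm z hz).trans (by gcongr)
            _ = _ := by field_simp
        calc _ ≤ _ := h3
          _ ≤ u⁻¹ ^ p * C₂ ^ p := by
              rw [pow_mul, inv_pow, hlE, hC₂, ← Real.exp_nat_mul]
              gcongr
          _ = (1 * C₂ * u⁻¹) ^ p := by rw [one_mul, mul_pow, mul_comm]
          _ ≤ _ := by gcongr; linarith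
    have hu0 : 0 < u := by linarith
    calc _ ≤ (2 * C₁ * C₂ * u⁻¹) ^ p * (c⁻¹ * u) ^ p := by
          gcongr
          exact Finset.prod_nonneg fun q _ => (mul_pos (h.pos q) hr).le
      _ = _ := by
          rw [← mul_pow]
          congr 1
          field_simp
  · intro z hz n p _
    refine (hone z hz (2 * E * p) n p).trans ?_
    have hr : 0 < ‖z‖ := norm_pos_iff.2 hz.1
    have : 0 ≤ ∏ q ∈ Finset.Ico p n, ν q * ‖z‖ :=
      Finset.prod_nonneg fun q _ => (mul_pos (h.pos q) hr).le
    rw [pow_mul]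
    gcongr
    calc C₁ = 1 * C₁ * 1 * 1 := by ring
      _ ≤ _ := by gcongr; norm_num

end PowerGrowth

lemma ofReal_mul_mem_sector {γ η : ℝ} (hη : 0 < η) {z : ℂ} (hz : z ∈ sector γ) :
    (η : ℂ) * z ∈ sector γ :=
  ⟨mul_ne_zero (by exact_mod_cast hη.ne') hz.1, by rw [Complex.arg_real_mul _ hη]; exact hz.2⟩

/-- Borel–Ritt with bounds: a formal power series whose coefficients are dominated by
`∏_{q<p} ν q` is the asymptotic expansion of a holomorphic function on a sector, with remainders
controlled by the same products. -/
theorem PowerGrowth.exists_asymptotic_expansion {ν : ℕ → ℝ} {c β D : ℝ} {B : ℕ}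
    (h : PowerGrowth ν c β D B) {γ : ℝ} (hγ0 : 0 < γ) (hγ2 : γ ≤ 2) (hγβ : γ < β)
    {a : ℕ → ℂ} {A : ℝ} (hA : 0 ≤ A) (ha : ∀ p, ‖a p‖ ≤ A * ∏ q ∈ Finset.range p, ν q) :
    ∃ C : ℝ, 0 < C ∧ ∃ f : ℂ → ℂ, DifferentiableOn ℂ f (sector γ) ∧
      ∀ z ∈ sector γ, ∀ n, ‖f z - ∑ k ∈ Finset.range n, a k * z ^ k‖ ≤
        3 * A * (C ^ n * (∏ q ∈ Finset.range n, ν q) * ‖z‖ ^ n) := by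
  obtain ⟨C, hC1, χ, hχd, hχ, hχ'⟩ := h.exists_cutoffs hγ0 hγ2 hγβ
  have hC : 0 < C := by linarith
  set η : ℝ := 2 * C with hη
  have hη0 : 0 < η := by positivity
  have hprod : ∀ z : ℂ, ∀ n p, n ≤ p →
      (∏ q ∈ Finset.range n, ν q) * ‖z‖ ^ n * (∏ q ∈ Finset.Ico n p, ν q * ‖(η : ℂ) * z‖) =
        (∏ q ∈ Finset.range p, ν q) * ‖z‖ ^ p * η ^ (p - n) := fun z n p hnp => by
    rw [Finset.prod_mul_distrib, Finset.prod_const, Nat.card_Ico, norm_mul,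
      Complex.norm_of_nonneg hη0.le, mul_pow, ← Finset.prod_range_mul_prod_Ico ν hnp]
    have : ‖z‖ ^ p = ‖z‖ ^ n * ‖z‖ ^ (p - n) := by rw [← pow_add]; congr 1; omega
    rw [this]; ring
  have hN : ∀ n, 0 < ∏ q ∈ Finset.range n, ν q := fun n => Finset.prod_pos fun q _ => h.pos q
  have hterm : ∀ z ∈ sector γ, ∀ n p, n ≤ p → ‖a p * z ^ p * χ p ((η : ℂ) * z)‖ ≤
      A * (C ^ n * (∏ q ∈ Finset.range n, ν q) * ‖z‖ ^ n) * (1 / 2) ^ (p - n) := by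
    intro z hz n p hnp
    have h1 := hχ _ (ofReal_mul_mem_sector hη0 hz) n p hnp
    have h2 := hprod z n p hnp
    have h3 : C ^ p = C ^ n * (η ^ (p - n) * (1 / 2) ^ (p - n)) := by
      rw [← mul_pow, hη, mul_div_assoc', mul_one, mul_div_cancel_left₀ _ two_ne_zero, ← pow_add]
      congr 1; omega
    have h4 : 0 < η ^ (p - n) := by positivity
    have h5 := hN n
    refine le_of_mul_le_mul_right ?_ h4
    rw [norm_mul, norm_mul, norm_pow]
    calc _ ≤ A * (∏ q ∈ Finset.range p, ν q) * ‖z‖ ^ p * ‖χ p ((η : ℂ) * z)‖ * η ^ (p - n) := by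
          gcongr; exact ha p
      _ = A * ((∏ q ∈ Finset.range p, ν q) * ‖z‖ ^ p * η ^ (p - n)) * ‖χ p ((η : ℂ) * z)‖ := by
          ring
      _ = A * ((∏ q ∈ Finset.range n, ν q) * ‖z‖ ^ n) *
          (‖χ p ((η : ℂ) * z)‖ * ∏ q ∈ Finset.Ico n p, ν q * ‖(η : ℂ) * z‖) := by
          rw [← h2]; ring
      _ ≤ A * ((∏ q ∈ Finset.range n, ν q) * ‖z‖ ^ n) * C ^ p := by gcongr
      _ = _ := by rw [h3]; ring
  have hterm' : ∀ z ∈ sector γ, ∀ n k, k ≤ n → ‖a k * z ^ k * (1 - χ k ((η : ℂ) * z))‖ ≤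
      A * ((2 * C) ^ n * (∏ q ∈ Finset.range n, ν q) * ‖z‖ ^ n) := by
    intro z hz n k hkn
    have h1 := hχ' _ (ofReal_mul_mem_sector hη0 hz) n k hkn
    have h2 := hprod z k n hkn
    have h5 := hN n
    have h6 := hN k
    rw [norm_mul, norm_mul, norm_pow]
    calc _ ≤ A * (∏ q ∈ Finset.range k, ν q) * ‖z‖ ^ k *
          (C ^ k * ∏ q ∈ Finset.Ico k n, ν q * ‖(η : ℂ) * z‖) := by
          gcongr; exact ha k
      _ = A * C ^ k * ((∏ q ∈ Finset.range k, ν q) * ‖z‖ ^ k *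
          ∏ q ∈ Finset.Ico k n, ν q * ‖(η : ℂ) * z‖) := by ring
      _ = A * C ^ k * ((∏ q ∈ Finset.range n, ν q) * ‖z‖ ^ n * η ^ (n - k)) := by rw [h2]
      _ ≤ A * (2 * C) ^ k * ((∏ q ∈ Finset.range n, ν q) * ‖z‖ ^ n * η ^ (n - k)) := by
          gcongr; linarith
      _ = A * ((2 * C) ^ k * η ^ (n - k)) * ((∏ q ∈ Finset.range n, ν q) * ‖z‖ ^ n) := by ring
      _ = _ := by
          rw [hη, ← pow_add, Nat.add_sub_cancel' hkn]; ring
  have hgeom : Summable fun p : ℕ => A * (1 / 2 : ℝ) ^ p := summable_geometric_two.mul_left A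
  have hbound : ∀ p, ∀ z ∈ sector γ, ‖a p * z ^ p * χ p ((η : ℂ) * z)‖ ≤ A * (1 / 2 : ℝ) ^ p :=
    fun p z hz => by simpa using hterm z hz 0 p (Nat.zero_le p)
  refine ⟨4 * C, by positivity, fun z => ∑' p, a p * z ^ p * χ p ((η : ℂ) * z), ?_, ?_⟩
  · refine Complex.differentiableOn_tsum_of_summable_norm hgeom (fun p => ?_)
      (isOpen_sector hγ2) hbound
    refine DifferentiableOn.mul (by fun_prop) ?_
    exact (hχd p).comp (by fun_prop) fun z hz => ofReal_mul_mem_sector hη0 hz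
  · intro z hz n
    have hs : Summable fun p => a p * z ^ p * χ p ((η : ℂ) * z) :=
      Summable.of_norm_bounded hgeom fun p => hbound p z hz
    have hsplit : ∑' p, a p * z ^ p * χ p ((η : ℂ) * z) - ∑ k ∈ Finset.range n, a k * z ^ k =
        ∑' p, a (p + n) * z ^ (p + n) * χ (p + n) ((η : ℂ) * z) -
          ∑ k ∈ Finset.range n, a k * z ^ k * (1 - χ k ((η : ℂ) * z)) := by
      rw [← hs.sum_add_tsum_nat_add n]
      simp only [mul_sub, mul_one, Finset.sum_sub_distrib]
      ring
    set T : ℝ := (∏ q ∈ Finset.range n, ν q) * ‖z‖ ^ n with hT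
    have hT0 : 0 ≤ T := mul_nonneg (hN n).le (by positivity)
    have htail : ‖∑' p, a (p + n) * z ^ (p + n) * χ (p + n) ((η : ℂ) * z)‖ ≤
        A * (C ^ n * T) * 2 := by
      refine tsum_of_norm_bounded (hasSum_geometric_two.mul_left (A * (C ^ n * T))) fun p => ?_
      simpa [mul_assoc, hT] using hterm z hz n (p + n) (Nat.le_add_left n p)
    have hhead : ‖∑ k ∈ Finset.range n, a k * z ^ k * (1 - χ k ((η : ℂ) * z))‖ ≤
        n * (A * ((2 * C) ^ n * T)) := by
      refine (norm_sum_le_of_le _ fun k hk => ?_).trans (by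
        rw [Finset.sum_const, Finset.card_range, nsmul_eq_mul])
      simpa [mul_assoc, hT] using hterm' z hz n k (Finset.mem_range.1 hk).le
    have hn : (n : ℝ) ≤ 2 ^ n := by exact_mod_cast (Nat.lt_two_pow_self (n := n)).le
    have h4 : C ^ n ≤ (4 * C) ^ n := by gcongr; linarith
    rw [hsplit]
    calc _ ≤ A * (C ^ n * T) * 2 + n * (A * ((2 * C) ^ n * T)) :=
          (norm_sub_le _ _).trans (add_le_add htail hhead)
      _ ≤ A * ((4 * C) ^ n * T) * 2 + 2 ^ n * (A * ((2 * C) ^ n * T)) := by gcongr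
      _ = 3 * A * ((4 * C) ^ n * T) := by
          have : (4 * C) ^ n = 2 ^ n * (2 * C) ^ n := by rw [← mul_pow]; ring
          rw [this]; ring
      _ = _ := by rw [hT]; ring

lemma exists_closedBall_subset_sector {γ γ' : ℝ} (hγ' : γ' ≤ 2) (h : γ < γ') :
    ∃ ρ : ℝ, 0 < ρ ∧ ρ ≤ 1 ∧ ∀ z ∈ sector γ, Metric.closedBall z (ρ * ‖z‖) ⊆ sector γ' := by
  have hpi := Real.pi_pos
  have hcont : ∀ᶠ w : ℂ in nhds 1, |w.arg| < (γ' - γ) * Real.pi / 2 := by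
    have h1 := (Complex.continuousAt_arg Complex.one_mem_slitPlane).abs
    refine h1.eventually_lt_const ?_
    simp only [Complex.arg_one, abs_zero]
    have : 0 < γ' - γ := by linarith
    positivity
  obtain ⟨ρ, hρ, hball⟩ := Metric.eventually_nhds_iff_ball.1
    (hcont.and (eventually_ne_nhds (one_ne_zero (α := ℂ))))
  refine ⟨min (ρ / 2) 1, by positivity, min_le_right _ _, fun z hz u hu => ?_⟩
  have hz0 : 0 < ‖z‖ := norm_pos_iff.2 hz.1
  have hw : u / z ∈ Metric.ball (1 : ℂ) ρ := by
    rw [Metric.mem_closedBall, dist_eq_norm] at hu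
    rw [Metric.mem_ball, dist_eq_norm, div_sub_one hz.1, norm_div, div_lt_iff₀ hz0]
    refine hu.trans_lt ?_
    have := min_le_left (ρ / 2) 1
    gcongr
    linarith
  obtain ⟨h1, h2⟩ := hball _ hw
  have hu' : u = z * (u / z) := by rw [mul_div_cancel₀ _ hz.1]
  have h3 := hz.2
  have h4 : |z.arg + (u / z).arg| < γ' * Real.pi / 2 :=
    (abs_add_le _ _).trans_lt (by linarith)
  have h5 : γ' * Real.pi / 2 ≤ Real.pi := by nlinarith
  rw [hu']
  refine ⟨mul_ne_zero hz.1 h2, ?_⟩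
  rw [Complex.arg_mul hz.1 h2 ⟨by linarith [(abs_lt.1 h4).1], by linarith [(abs_lt.1 h4).2]⟩]
  exact h4

lemma iteratedDeriv_sum_mul_pow (a : ℕ → ℂ) (n p : ℕ) (z : ℂ) :
    iteratedDeriv p (fun w => ∑ k ∈ Finset.range n, a k * w ^ k) z =
      ∑ k ∈ Finset.range n, a k * (k.descFactorial p * z ^ (k - p)) := by
  rw [iteratedDeriv_fun_sum fun k _ => by fun_prop]
  refine Finset.sum_congr rfl fun k _ => ?_
  rw [iteratedDeriv_const_mul_field, iteratedDeriv_pow]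

/-- Remainder bounds on a sector give bounds for the derivatives of the remainders on a smaller
sector, by the Cauchy estimates. -/
lemma norm_iteratedDeriv_sub_le {γ γ' : ℝ} (hγ' : γ' ≤ 2) (h : γ < γ') {f : ℂ → ℂ}
    (hf : DifferentiableOn ℂ f (sector γ')) {a : ℕ → ℂ} {R : ℕ → ℝ}
    (hR : ∀ z ∈ sector γ', ∀ n,
      ‖f z - ∑ k ∈ Finset.range n, a k * z ^ k‖ ≤ R n * ‖z‖ ^ n) :
    ∃ ρ : ℝ, 0 < ρ ∧ ∀ z ∈ sector γ, ∀ n p,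
      ‖iteratedDeriv p f z - ∑ k ∈ Finset.range n, a k * (k.descFactorial p * z ^ (k - p))‖ ≤
        p.factorial * (R n * (2 * ‖z‖) ^ n) / (ρ * ‖z‖) ^ p := by
  obtain ⟨ρ, hρ, hρ1, hball⟩ := exists_closedBall_subset_sector hγ' h
  refine ⟨ρ, hρ, fun z hz n p => ?_⟩
  have hz0 : 0 < ‖z‖ := norm_pos_iff.2 hz.1
  have hzmem : z ∈ sector γ' := hball z hz (Metric.mem_closedBall_self (by positivity))
  have hRn : 0 ≤ R n := by
    have := (norm_nonneg _).trans (hR z hzmem n)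
    exact nonneg_of_mul_nonneg_left this (by positivity)
  have hfz : ContDiffAt ℂ p f z :=
    (hf.contDiffOn (isOpen_sector hγ')).contDiffAt ((isOpen_sector hγ').mem_nhds hzmem)
  rw [← iteratedDeriv_sum_mul_pow, ← iteratedDeriv_fun_sub hfz (by fun_prop)]
  refine Complex.norm_iteratedDeriv_le_of_forall_mem_sphere_norm_le p (by positivity) ?_ ?_
  · refine DifferentiableOn.diffContOnCl ?_
    rw [closure_ball z (by positivity)]
    exact (hf.mono (hball z hz)).sub (by fun_prop)
  · intro w hw
    have hw' := Metric.sphere_subset_closedBall hw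
    refine (hR w (hball z hz hw') n).trans ?_
    have : ‖w‖ ≤ 2 * ‖z‖ := by
      rw [Metric.mem_closedBall, dist_eq_norm] at hw'
      have h1 := norm_le_norm_add_norm_sub' w z
      nlinarith
    gcongr

/-- The Borel map in a sector: a sequence dominated by `p! ∏_{q<p} ν q` is realized by the
derivatives at the vertex of a holomorphic function whose derivatives satisfy the same bounds, up
to a geometric factor. -/
theorem PowerGrowth.exists_derivatives_at_vertex {ν : ℕ → ℝ} {c β D : ℝ} {B : ℕ}
    (h : PowerGrowth ν c β D B) {γ : ℝ} (hγ0 : 0 < γ) (hγ2 : γ < 2) (hγβ : γ < β)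
    {lam : ℕ → ℂ} {A : ℝ} (hA : 0 ≤ A)
    (hlam : ∀ p, ‖lam p‖ ≤ A * (p.factorial * ∏ q ∈ Finset.range p, ν q)) :
    ∃ C : ℝ, 0 < C ∧ ∃ f : ℂ → ℂ, DifferentiableOn ℂ f (sector γ) ∧
      (∀ z ∈ sector γ, ∀ p,
        ‖iteratedDeriv p f z‖ ≤ 3 * A * (C ^ p * (p.factorial * ∏ q ∈ Finset.range p, ν q))) ∧
      ∀ p, Tendsto (iteratedDeriv p f) (nhdsWithin 0 (sector γ)) (nhds (lam p)) := by
  obtain ⟨γ', hγγ', hγ'⟩ := exists_between (lt_min hγ2 hγβ)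
  have hγ'2 : γ' ≤ 2 := (hγ'.trans_le (min_le_left _ _)).le
  have hγ'β : γ' < β := hγ'.trans_le (min_le_right _ _)
  have hfac : ∀ p : ℕ, 0 < (p.factorial : ℝ) := fun p => by exact_mod_cast p.factorial_pos
  set a : ℕ → ℂ := fun p => lam p / p.factorial with ha_def
  have ha : ∀ p, ‖a p‖ ≤ A * ∏ q ∈ Finset.range p, ν q := fun p => by
    rw [ha_def]
    simp only [norm_div, Complex.norm_natCast]
    rw [div_le_iff₀ (hfac p)]
    linarith [hlam p]
  obtain ⟨C, hC, f, hf, hR⟩ :=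
    h.exists_asymptotic_expansion (hγ0.trans hγγ') hγ'2 hγ'β hA ha
  set R : ℕ → ℝ := fun n => 3 * A * (C ^ n * ∏ q ∈ Finset.range n, ν q) with hR_def
  obtain ⟨ρ, hρ, hder⟩ := norm_iteratedDeriv_sub_le hγ'2 hγγ' hf (R := R) fun z hz n =>
    (hR z hz n).trans_eq (by rw [hR_def]; ring)
  have hsub : sector γ ⊆ sector γ' := fun z hz =>
    ⟨hz.1, hz.2.trans (by have := Real.pi_pos; gcongr)⟩
  refine ⟨C * 2 / ρ, by positivity, f, hf.mono hsub, fun z hz p => ?_, fun p => ?_⟩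
  · have hz0 : 0 < ‖z‖ := norm_pos_iff.2 hz.1
    have h1 := hder z hz p p
    rw [Finset.sum_eq_zero fun k hk => by
      rw [Nat.descFactorial_of_lt (Finset.mem_range.1 hk)]; simp, sub_zero] at h1
    refine h1.trans_eq ?_
    rw [hR_def, div_pow, mul_pow, mul_pow, mul_pow]
    field_simp
  · rw [tendsto_iff_norm_sub_tendsto_zero]
    set T : ℝ := p.factorial * R (p + 1) * 2 ^ (p + 1) / ρ ^ p with hT
    have hlim : Tendsto (fun z : ℂ => T * ‖z‖) (nhdsWithin 0 (sector γ)) (nhds 0) := by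
      have : Continuous fun z : ℂ => T * ‖z‖ := by fun_prop
      simpa using (this.tendsto 0).mono_left nhdsWithin_le_nhds
    refine squeeze_zero' (Eventually.of_forall fun z => norm_nonneg _) ?_ hlim
    filter_upwards [self_mem_nhdsWithin] with z hz
    have hz0 : 0 < ‖z‖ := norm_pos_iff.2 hz.1
    have h1 := hder z hz (p + 1) p
    rw [Finset.sum_range_succ, Finset.sum_eq_zero fun k hk => by
      rw [Nat.descFactorial_of_lt (Finset.mem_range.1 hk)]; simp, zero_add,
      Nat.descFactorial_self, Nat.sub_self, pow_zero, mul_one, ha_def,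
      div_mul_cancel₀ _ (by exact_mod_cast p.factorial_ne_zero)] at h1
    refine h1.trans_eq ?_
    rw [hT, mul_pow, mul_pow]
    field_simp
    ring

/-- A null sequence is dominated by a nonincreasing null sequence which decays slower than a
prescribed power. -/
lemma exists_slowly_decreasing_majorant {e : ℕ → ℝ} (he : ∀ k, 0 < e k)
    (he0 : Tendsto e atTop (nhds 0)) {δ : ℝ} (hδ : 0 < δ) :
    ∃ ε : ℕ → ℝ, (∀ k, e k ≤ ε k) ∧ Antitone ε ∧
      (∀ q p : ℕ, q ≤ p → ε q ≤ (((p : ℝ) + 1) / (q + 1)) ^ δ * ε p) ∧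
      Tendsto ε atTop (nhds 0) := by
  obtain ⟨E, hE⟩ := he0.bddAbove_range
  have hE' : ∀ k, e k ≤ E := fun k => hE (mem_range_self k)
  have hE0 : 0 < E := (he 0).trans_le (hE' 0)
  set w : ℕ → ℕ → ℝ := fun p k => min 1 ((((k : ℝ) + 1) / (p + 1)) ^ δ) * e k with hw
  have hw0 : ∀ p k, 0 ≤ w p k := fun p k => by have := he k; simp only [hw]; positivity
  have hwE : ∀ p k, w p k ≤ e k := fun p k =>
    mul_le_of_le_one_left (he k).le (min_le_left _ _)
  have hbdd : ∀ p, BddAbove (range (w p)) := fun p =>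
    ⟨E, by rintro _ ⟨k, rfl⟩; exact (hwE p k).trans (hE' k)⟩
  have hle : ∀ p k, w p k ≤ ⨆ k, w p k := fun p k => le_ciSup (hbdd p) k
  refine ⟨fun p => ⨆ k, w p k, fun k => ?_, fun q p hqp => ?_, fun q p hqp => ?_, ?_⟩
  · refine le_trans ?_ (hle k k)
    have : ((k : ℝ) + 1) / (k + 1) = 1 := div_self (by positivity)
    simp only [hw, this, Real.one_rpow, min_self, one_mul, le_refl]
  · refine ciSup_le fun k => (le_trans ?_ (hle q k))
    have : (q : ℝ) ≤ p := by exact_mod_cast hqp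
    have := he k
    simp only [hw]
    gcongr
  · refine ciSup_le fun k => ?_
    have hqp' : (q : ℝ) ≤ p := by exact_mod_cast hqp
    have hek := he k
    have h1 : 1 ≤ (((p : ℝ) + 1) / (q + 1)) ^ δ :=
      Real.one_le_rpow (by rw [one_le_div (by positivity)]; linarith) hδ.le
    refine le_trans ?_ (mul_le_mul_of_nonneg_left (hle p k) (by positivity))
    simp only [hw]
    rw [← mul_assoc]
    refine mul_le_mul_of_nonneg_right ?_ hek.le
    rw [mul_min_of_nonneg _ _ (by positivity), mul_one, ← Real.mul_rpow (by positivity)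
      (by positivity)]
    refine min_le_min h1 (le_of_eq ?_)
    congr 1
    field_simp
  · rw [Metric.tendsto_atTop]
    intro η hη
    obtain ⟨k₀, hk₀⟩ := (he0.eventually_le_const (half_pos (half_pos hη))).exists_forall_of_atTop
    have hlim : Tendsto (fun p : ℕ => (((k₀ : ℝ) + 1) / (p + 1)) ^ δ * E) atTop (nhds 0) := by
      have h1 : Tendsto (fun p : ℕ => ((k₀ : ℝ) + 1) / ((p : ℝ) + 1)) atTop (nhds 0) :=
        tendsto_const_nhds.div_atTop
          (tendsto_atTop_add_const_right _ _ tendsto_natCast_atTop_atTop)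
      have h2 := h1.rpow_const (p := δ) (Or.inr hδ.le)
      rw [Real.zero_rpow hδ.ne'] at h2
      simpa using h2.mul_const E
    obtain ⟨P, hP⟩ := (hlim.eventually_le_const (half_pos (half_pos hη))).exists_forall_of_atTop
    refine ⟨P, fun p hp => ?_⟩
    have h0 : 0 ≤ ⨆ k, w p k := (hw0 p 0).trans (hle p 0)
    rw [Real.dist_0_eq_abs, abs_of_nonneg h0]
    refine lt_of_le_of_lt (ciSup_le fun k => ?_) (half_lt_self hη)
    have hp1 := hP p hp
    rcases le_total k₀ k with hk | hk
    · have := (hwE p k).trans (hk₀ k hk)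
      linarith
    · have hk' : (k : ℝ) ≤ k₀ := by exact_mod_cast hk
      have : w p k ≤ (((k₀ : ℝ) + 1) / (p + 1)) ^ δ * E := by
        simp only [hw]
        refine mul_le_mul ((min_le_right _ _).trans ?_) (hE' k) (he k).le (by positivity)
        gcongr
      linarith

/-- The partial products of a null sequence decay faster than any geometric sequence. -/
lemma exists_prod_le_mul_pow {ε : ℕ → ℝ} (hε : ∀ k, 0 < ε k)
    (hε0 : Tendsto ε atTop (nhds 0)) {h : ℝ} (hh : 0 < h) :
    ∃ C : ℝ, ∀ p, ∏ q ∈ Finset.range p, ε q ≤ C * h ^ p := by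
  obtain ⟨Q, hQ⟩ := (hε0.eventually_le_const hh).exists_forall_of_atTop
  set u : ℕ → ℝ := fun p => ∏ q ∈ Finset.range p, ε q / h with hu
  have hu0 : ∀ p, 0 < u p := fun p => Finset.prod_pos fun q _ => div_pos (hε q) hh
  have hle : ∀ p, Q ≤ p → u p ≤ u Q := fun p hp => by
    induction p, hp using Nat.le_induction with
    | base => exact le_rfl
    | succ p hp ih =>
      refine le_trans ?_ ih
      simp only [hu, Finset.prod_range_succ]
      exact mul_le_of_le_one_right (hu0 p).le ((div_le_one hh).2 (hQ p hp))
  have hsum : ∀ i ∈ Finset.range (Q + 1), u i ≤ ∑ i ∈ Finset.range (Q + 1), u i := fun i hi =>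
    Finset.single_le_sum (f := u) (fun j _ => (hu0 j).le) hi
  refine ⟨∑ i ∈ Finset.range (Q + 1), u i, fun p => ?_⟩
  have hup : u p ≤ ∑ i ∈ Finset.range (Q + 1), u i := by
    rcases le_total Q p with hp | hp
    · exact (hle p hp).trans (hsum Q (by simp))
    · exact hsum p (by simp; omega)
  rw [← div_le_iff₀ (by positivity)]
  simpa [hu, Finset.prod_div_distrib] using hup

/-- A sequence decaying faster than any geometric sequence is dominated by the partial products
of a slowly decreasing null sequence. -/
lemma exists_slowly_decreasing_prod_majorant {r : ℕ → ℝ} (hr : ∀ p, 0 ≤ r p)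
    (hrh : ∀ h : ℝ, 0 < h → ∃ A : ℝ, ∀ p, r p ≤ A * h ^ p) {δ : ℝ} (hδ : 0 < δ) :
    ∃ ε : ℕ → ℝ, (∀ k, 0 < ε k) ∧ Antitone ε ∧
      (∀ q p : ℕ, q ≤ p → ε q ≤ (((p : ℝ) + 1) / (q + 1)) ^ δ * ε p) ∧
      Tendsto ε atTop (nhds 0) ∧
      ∀ p, r (p + 1) ≤ ∏ q ∈ Finset.range (p + 1), ε q := by
  set e : ℕ → ℝ := fun k => r (k + 1) ^ (((k + 1 : ℕ) : ℝ)⁻¹) + 1 / ((k : ℝ) + 1) with he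
  have hroot : ∀ k, 0 ≤ r (k + 1) ^ (((k + 1 : ℕ) : ℝ)⁻¹) := fun k => Real.rpow_nonneg (hr _) _
  have hepos : ∀ k, 0 < e k := fun k => add_pos_of_nonneg_of_pos (hroot k) (by positivity)
  have he0 : Tendsto e atTop (nhds 0) := by
    rw [← add_zero (0 : ℝ)]
    refine Tendsto.add ?_ tendsto_one_div_add_atTop_nhds_zero_nat
    rw [Metric.tendsto_atTop]
    intro η hη
    obtain ⟨A, hA⟩ := hrh (η / 4) (by positivity)
    obtain ⟨K, hK⟩ := ((tendsto_pow_atTop_atTop_of_one_lt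
      (one_lt_two (α := ℝ))).eventually_ge_atTop A).exists_forall_of_atTop
    refine ⟨K, fun k hk => ?_⟩
    rw [Real.dist_0_eq_abs, abs_of_nonneg (hroot k)]
    have h1 : r (k + 1) ≤ (η / 2) ^ (k + 1) := by
      refine (hA _).trans ?_
      have h2 : (η / 2) ^ (k + 1) = 2 ^ (k + 1) * (η / 4) ^ (k + 1) := by
        rw [← mul_pow]; ring
      rw [h2]
      gcongr
      exact hK _ (by omega)
    calc _ ≤ ((η / 2) ^ (k + 1)) ^ (((k + 1 : ℕ) : ℝ)⁻¹) :=
          Real.rpow_le_rpow (hr _) h1 (by positivity)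
      _ = η / 2 := Real.pow_rpow_inv_natCast (by positivity) (by omega)
      _ < η := half_lt_self hη
  obtain ⟨ε, h1, h2, h3, h4⟩ := exists_slowly_decreasing_majorant hepos he0 hδ
  have hε : ∀ k, 0 < ε k := fun k => (hepos k).trans_le (h1 k)
  refine ⟨ε, hε, h2, h3, h4, fun p => ?_⟩
  calc r (p + 1) = (r (p + 1) ^ (((p + 1 : ℕ) : ℝ)⁻¹)) ^ (p + 1) :=
        (Real.rpow_inv_natCast_pow (hr _) (by omega)).symm
    _ ≤ (ε p) ^ (p + 1) := by
        refine pow_le_pow_left₀ (hroot p) (le_trans ?_ (h1 p)) _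
        simp only [he]
        have : 0 ≤ 1 / ((p : ℝ) + 1) := by positivity
        linarith
    _ = ∏ q ∈ Finset.range (p + 1), ε p := by simp
    _ ≤ _ := Finset.prod_le_prod (fun _ _ => (hε p).le) fun q hq =>
        h2 (by have := Finset.mem_range.1 hq; omega)

/-- The sequence of quotients of consecutive terms. -/
noncomputable def quot (M : ℕ → ℝ) (q : ℕ) : ℝ := M (q + 1) / M q

namespace LCseq

variable {M : ℕ → ℝ}

lemma quot_pos (hM : LCseq M) (q : ℕ) : 0 < quot M q := div_pos (hM.1 _) (hM.1 _)

lemma quot_mul (hM : LCseq M) (q : ℕ) : quot M q * M q = M (q + 1) :=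
  div_mul_cancel₀ _ (hM.1 q).ne'

lemma prod_quot (hM : LCseq M) (p : ℕ) : ∏ q ∈ Finset.range p, quot M q = M p := by
  induction p with
  | zero => simp [hM.2.1]
  | succ p ih => rw [Finset.prod_range_succ, ih, mul_comm, hM.quot_mul]

lemma quot_mono (hM : LCseq M) : Monotone (quot M) := by
  refine monotone_nat_of_le_succ fun q => ?_
  have h := hM.2.2.2.1 (q + 1) (by omega)
  rw [quot, quot, div_le_div_iff₀ (hM.1 _) (hM.1 _)]
  simp only [Nat.add_sub_cancel] at h
  linarith

lemma quot_pow_mul_le (hM : LCseq M) {j n : ℕ} (hjn : j ≤ n) (k : ℕ) :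
    quot M j ^ k * M n ≤ M (n + k) := by
  induction k with
  | zero => simp
  | succ k ih =>
    have h := hM.quot_mono (show j ≤ n + k by omega)
    have := hM.quot_pos j
    have := hM.1 (n + k)
    calc quot M j ^ (k + 1) * M n = quot M j * (quot M j ^ k * M n) := by ring
      _ ≤ quot M (n + k) * M (n + k) := mul_le_mul h ih (by have := hM.1 n; positivity)
          (by linarith)
      _ = _ := hM.quot_mul _

lemma le_quot_pow_mul (hM : LCseq M) {j n k : ℕ} (hj : n + k ≤ j + 1) :
    M (n + k) ≤ quot M j ^ k * M n := by
  induction k with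
  | zero => simp
  | succ k ih =>
    have h := hM.quot_mono (show n + k ≤ j by omega)
    have := hM.quot_pos j
    have := hM.1 (n + k)
    calc M (n + (k + 1)) = quot M (n + k) * M (n + k) := (hM.quot_mul _).symm
      _ ≤ quot M j * (quot M j ^ k * M n) := by gcongr; exact ih (by omega)
      _ = _ := by ring

lemma le_quot_pow (hM : LCseq M) {j k : ℕ} (hj : k ≤ j + 1) : M k ≤ quot M j ^ k := by
  simpa [hM.2.1] using hM.le_quot_pow_mul (n := 0) (k := k) (j := j) (by omega)

lemma tendsto_quot (hM : LCseq M) : Tendsto (quot M) atTop atTop := by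
  refine tendsto_atTop_mono' _ ?_ hM.2.2.2.2
  filter_upwards [eventually_ge_atTop 1] with p hp
  have hq := (hM.quot_pos p).le
  calc M p ^ ((1 : ℝ) / p) ≤ (quot M p ^ p) ^ ((1 : ℝ) / p) :=
        Real.rpow_le_rpow (hM.1 p).le (hM.le_quot_pow (by omega)) (by positivity)
    _ = quot M p := by rw [one_div, Real.pow_rpow_inv_natCast hq (by omega)]

/-- The supremum defining the associated function at a quotient is attained at its index. -/
lemma quot_pow_div_le (hM : LCseq M) (n p : ℕ) :
    quot M n ^ p / M p ≤ quot M n ^ n / M n := by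
  have hq := hM.quot_pos n
  rw [div_le_div_iff₀ (hM.1 _) (hM.1 _)]
  rcases le_total n p with h | h
  · obtain ⟨k, rfl⟩ := Nat.exists_eq_add_of_le h
    calc _ = quot M n ^ n * (quot M n ^ k * M n) := by ring
      _ ≤ _ := by gcongr; exact hM.quot_pow_mul_le le_rfl k
  · obtain ⟨k, rfl⟩ := Nat.exists_eq_add_of_le h
    calc _ ≤ quot M (p + k) ^ p * (quot M (p + k) ^ k * M p) := by
          gcongr; exact hM.le_quot_pow_mul (by omega)
      _ = _ := by ring

lemma log_pow_div_le (hM : LCseq M) {t : ℝ} (ht : 0 < t) {n : ℕ} (htn : t ≤ quot M n) (p : ℕ) :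
    Real.log (t ^ p / M p) ≤ Real.log (quot M n ^ n / M n) := by
  have := hM.1 p
  refine Real.log_le_log (by positivity) (le_trans ?_ (hM.quot_pow_div_le n p))
  gcongr

lemma bddAbove_log (hM : LCseq M) {t : ℝ} (ht : 0 < t) :
    BddAbove (range fun p => Real.log (t ^ p / M p)) := by
  obtain ⟨n, hn⟩ := (hM.tendsto_quot.eventually_ge_atTop t).exists
  exact ⟨_, by rintro _ ⟨p, rfl⟩; exact hM.log_pow_div_le ht hn p⟩

lemma log_le_assocWeight (hM : LCseq M) {t : ℝ} (ht : 0 < t) (p : ℕ) :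
    Real.log (t ^ p / M p) ≤ assocWeight M t := by
  rw [assocWeight, if_neg ht.not_ge]
  exact le_ciSup (hM.bddAbove_log ht) p

lemma assocWeight_mono (hM : LCseq M) {s t : ℝ} (hs : 0 < s) (hst : s ≤ t) :
    assocWeight M s ≤ assocWeight M t := by
  have ht := hs.trans_le hst
  nth_rw 1 [assocWeight]
  rw [if_neg hs.not_ge]
  refine ciSup_le fun p => le_trans ?_ (hM.log_le_assocWeight ht p)
  have := hM.1 p
  refine Real.log_le_log (by positivity) ?_
  gcongr

lemma succ_le_assocWeight (hM : LCseq M) (q : ℕ) :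
    (q : ℝ) + 1 ≤ assocWeight M (Real.exp 1 * quot M q) := by
  have hq := hM.quot_pos q
  refine le_trans ?_ (hM.log_le_assocWeight (by positivity) (q + 1))
  rw [Real.le_log_iff_exp_le (by have := hM.1 (q + 1); positivity), le_div_iff₀ (hM.1 _), mul_pow,
    ← Real.exp_nat_mul]
  push_cast
  rw [mul_one]
  gcongr
  exact hM.le_quot_pow (by omega)

lemma eventually_assocWeight_pos (hM : LCseq M) : ∀ᶠ t in atTop, 0 < assocWeight M t := by
  have hq := hM.quot_pos 0
  filter_upwards [eventually_ge_atTop (Real.exp 1 * quot M 0)] with t ht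
  have h := (hM.succ_le_assocWeight 0).trans (hM.assocWeight_mono (by positivity) ht)
  norm_num at h
  linarith

section ModerateGrowth

variable {C : ℝ}

lemma quot_pow_succ_le (hM : LCseq M)
    (hmg : ∀ j k : ℕ, M (j + k) ≤ C ^ (j + k) * M j * M k) (q : ℕ) :
    quot M q ^ (q + 1) ≤ C ^ (2 * q + 1) * M (q + 1) := by
  have h1 := (hM.quot_pow_mul_le (le_refl q) (q + 1)).trans (hmg q (q + 1))
  rw [show q + (q + 1) = 2 * q + 1 by ring] at h1
  refine le_of_mul_le_mul_right (h1.trans_eq ?_) (hM.1 q)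
  ring

lemma assocWeight_quot_le (hM : LCseq M) (hC : 1 ≤ C)
    (hmg : ∀ j k : ℕ, M (j + k) ≤ C ^ (j + k) * M j * M k) (q : ℕ) :
    assocWeight M (quot M q) ≤ 2 * Real.log C * (q + 1) := by
  have hq := hM.quot_pos q
  rw [assocWeight, if_neg hq.not_ge]
  refine ciSup_le fun p => (hM.log_pow_div_le hq le_rfl p).trans ?_
  have h1 : quot M q ^ q / M q = quot M q ^ (q + 1) / M (q + 1) := by
    rw [← hM.quot_mul q, pow_succ, mul_comm (quot M q) (M q),
      mul_div_mul_right _ _ hq.ne']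
  have h2 : quot M q ^ (q + 1) / M (q + 1) ≤ C ^ (2 * q + 1) := by
    rw [div_le_iff₀ (hM.1 _)]
    exact hM.quot_pow_succ_le hmg q
  have hM1 := hM.1 (q + 1)
  have hlog := Real.log_nonneg hC
  rw [h1]
  calc _ ≤ Real.log (C ^ (2 * q + 1)) := Real.log_le_log (by positivity) h2
    _ = (2 * q + 1) * Real.log C := by rw [Real.log_pow]; push_cast; ring
    _ ≤ _ := by nlinarith

lemma quot_two_mul_add_one_le (hM : LCseq M) (hC : 1 ≤ C)
    (hmg : ∀ j k : ℕ, M (j + k) ≤ C ^ (j + k) * M j * M k) (q : ℕ) :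
    quot M (2 * q + 1) ≤ C ^ 3 * quot M q := by
  have hq := hM.quot_pos q
  have hC0 : 0 < C := by linarith
  refine le_of_pow_le_pow_left₀ (n := 2 * q + 2) (by omega) (by positivity) ?_
  have h1 := (hM.quot_pow_mul_le (le_refl (2 * q + 1)) (2 * q + 2)).trans (hmg _ _)
  have h2 := hmg (q + 1) (q + 1)
  have h3 := hM.le_quot_pow (le_refl (q + 1))
  rw [show q + 1 + (q + 1) = 2 * q + 2 by ring] at h2
  have hM1 := hM.1 (q + 1)
  have hM2 := hM.1 (2 * q + 2)
  refine le_of_mul_le_mul_right (h1.trans ?_) (hM.1 (2 * q + 1))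
  calc C ^ (2 * q + 1 + (2 * q + 2)) * M (2 * q + 1) * M (2 * q + 2)
      ≤ C ^ (2 * (2 * q + 2)) * M (2 * q + 1) *
        (C ^ (2 * q + 2) * quot M q ^ (q + 1) * quot M q ^ (q + 1)) := by
        have := hM.1 (2 * q + 1)
        refine mul_le_mul (mul_le_mul_of_nonneg_right (pow_le_pow_right₀ hC (by omega)) this.le)
          (h2.trans ?_) hM2.le (by positivity)
        gcongr
    _ = _ := by rw [mul_pow, ← pow_mul]; ring

/-- Under moderate growth the quotients grow at most polynomially. -/
lemma exists_quot_le (hM : LCseq M) (hC : 1 ≤ C)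
    (hmg : ∀ j k : ℕ, M (j + k) ≤ C ^ (j + k) * M j * M k) :
    ∃ B : ℕ, ∀ q p : ℕ, q ≤ p →
      quot M p ≤ 2 ^ B * (((p : ℝ) + 1) / (q + 1)) ^ B * quot M q := by
  obtain ⟨B, hB⟩ := pow_unbounded_of_one_lt (C ^ 3) (one_lt_two (α := ℝ))
  have hC3 : 1 ≤ C ^ 3 := one_le_pow₀ hC
  have hiter : ∀ q j : ℕ, quot M (2 ^ j * (q + 1) - 1) ≤ (C ^ 3) ^ j * quot M q := by
    intro q j
    induction j with
    | zero => simp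
    | succ j ih =>
      have hpos : 1 ≤ 2 ^ j * (q + 1) := Nat.one_le_iff_ne_zero.2 (by positivity)
      have h1 : 2 ^ (j + 1) * (q + 1) - 1 = 2 * (2 ^ j * (q + 1) - 1) + 1 := by
        rw [pow_succ', mul_assoc]; omega
      rw [h1, pow_succ', mul_assoc]
      refine (hM.quot_two_mul_add_one_le hC hmg _).trans ?_
      gcongr
  refine ⟨B, fun q p hqp => ?_⟩
  have hqp' : (q : ℝ) ≤ p := by exact_mod_cast hqp
  have hq0 := hM.quot_pos q
  obtain ⟨j, hj1, hj2⟩ := exists_nat_pow_near (x := ((p : ℝ) + 1) / (q + 1)) (y := 2)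
    (by rw [one_le_div (by positivity)]; linarith) one_lt_two
  rw [div_lt_iff₀ (by positivity)] at hj2
  have hj2' : p + 1 < 2 ^ (j + 1) * (q + 1) := by exact_mod_cast hj2
  calc quot M p ≤ quot M (2 ^ (j + 1) * (q + 1) - 1) := hM.quot_mono (by omega)
    _ ≤ (C ^ 3) ^ (j + 1) * quot M q := hiter q (j + 1)
    _ ≤ (2 ^ B) ^ (j + 1) * quot M q := by gcongr
    _ = 2 ^ B * (2 ^ j) ^ B * quot M q := by ring
    _ ≤ _ := by gcongr

/-- Under moderate growth, the growth condition on the associated function forces the quotients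
to grow at least like a power. -/
lemma exists_le_quot (hM : LCseq M) (hC : 1 ≤ C)
    (hmg : ∀ j k : ℕ, M (j + k) ≤ C ^ (j + k) * M j * M k) {α : ℝ} (hα : 0 < α)
    (hP : Pcond (assocWeight M) α) :
    ∃ G : ℝ, 1 ≤ G ∧ ∀ q p : ℕ, q ≤ p →
      (((p : ℝ) + 1) / (q + 1)) ^ α * quot M q ≤ G * quot M p := by
  obtain ⟨K, hK, c, hcK, hev⟩ := hP
  have hK0 : 0 < K := by linarith
  set Λ : ℝ := K ^ α with hΛ_def
  have hΛ : 1 < Λ := Real.one_lt_rpow hK hα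
  have hΛ0 : 0 < Λ := by linarith
  obtain ⟨t₀, ht₀⟩ := (hev.and (hM.eventually_assocWeight_pos.and
    (eventually_gt_atTop 0))).exists_forall_of_atTop
  have hstep : ∀ t, t₀ ≤ t → assocWeight M (Λ * t) ≤ K * assocWeight M t := fun t ht => by
    obtain ⟨h1, h2, -⟩ := ht₀ t ht
    rw [div_le_iff₀ h2] at h1
    exact h1.trans (by gcongr)
  have hiter : ∀ t, t₀ ≤ t → ∀ j : ℕ, assocWeight M (Λ ^ j * t) ≤ K ^ j * assocWeight M t := by
    intro t ht j
    induction j with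
    | zero => simp
    | succ j ih =>
      have ht0 := (ht₀ t ht).2.2
      have h1 : t ≤ Λ ^ j * t := le_mul_of_one_le_left ht0.le (one_le_pow₀ hΛ.le)
      rw [pow_succ', mul_assoc, pow_succ', mul_assoc]
      exact (hstep _ (ht.trans h1)).trans (by gcongr)
  obtain ⟨q₀, hq₀⟩ := (hM.tendsto_quot.eventually_ge_atTop t₀).exists_forall_of_atTop
  set L : ℝ := 2 * Real.log C with hL_def
  have hL : 0 ≤ L := by have := Real.log_nonneg hC; positivity
  have hlarge : ∀ q p : ℕ, q₀ ≤ q → q ≤ p →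
      (((p : ℝ) + 1) / (q + 1)) ^ α * quot M q ≤ (K * L) ^ α * Real.exp 1 * quot M p := by
    intro q p hq hqp
    have hquot := hM.quot_pos q
    have hquotp := hM.quot_pos p
    have hmono := hM.quot_mono hqp
    have he1 : 1 ≤ Real.exp 1 := Real.one_le_exp zero_le_one
    have hx1 : 1 ≤ Real.exp 1 * quot M p / quot M q := by
      rw [one_le_div hquot]
      nlinarith
    obtain ⟨j, hj1, hj2⟩ := exists_nat_pow_near hx1 hΛ
    rw [div_lt_iff₀ hquot] at hj2
    have h1 : (p : ℝ) + 1 ≤ K ^ (j + 1) * (L * (q + 1)) := by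
      calc (p : ℝ) + 1 ≤ assocWeight M (Real.exp 1 * quot M p) := hM.succ_le_assocWeight p
        _ ≤ assocWeight M (Λ ^ (j + 1) * quot M q) :=
          hM.assocWeight_mono (by positivity) hj2.le
        _ ≤ K ^ (j + 1) * assocWeight M (quot M q) := hiter _ (hq₀ q hq) _
        _ ≤ _ := by gcongr; exact hM.assocWeight_quot_le hC hmg q
    have h2 : ((p : ℝ) + 1) / (q + 1) ≤ K * L * K ^ j := by
      rw [div_le_iff₀ (by positivity)]
      exact h1.trans_eq (by ring)
    have h3 : (K ^ j) ^ α = Λ ^ j := by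
      rw [hΛ_def, ← Real.rpow_natCast, ← Real.rpow_natCast, ← Real.rpow_mul hK0.le,
        ← Real.rpow_mul hK0.le, mul_comm]
    calc (((p : ℝ) + 1) / (q + 1)) ^ α * quot M q ≤ (K * L * K ^ j) ^ α * quot M q := by gcongr
      _ = (K * L) ^ α * Λ ^ j * quot M q := by
        rw [Real.mul_rpow (by positivity) (by positivity), h3]
      _ ≤ (K * L) ^ α * (Real.exp 1 * quot M p / quot M q) * quot M q := by gcongr
      _ = _ := by field_simp
  set G₀ : ℝ := max 1 ((K * L) ^ α * Real.exp 1) with hG₀_def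
  have hG₀ : 1 ≤ G₀ := le_max_left _ _
  have hlarge' : ∀ q p : ℕ, q₀ ≤ q → q ≤ p →
      (((p : ℝ) + 1) / (q + 1)) ^ α * quot M q ≤ G₀ * quot M p := fun q p hq hqp => by
    have := hM.quot_pos p
    exact (hlarge q p hq hqp).trans (by gcongr; exact le_max_right _ _)
  have hq₀1 : 1 ≤ ((q₀ : ℝ) + 1) ^ α :=
    Real.one_le_rpow (by have := q₀.cast_nonneg (α := ℝ); linarith) hα.le
  refine ⟨((q₀ : ℝ) + 1) ^ α * G₀, one_le_mul_of_one_le_of_one_le hq₀1 hG₀, fun q p hqp => ?_⟩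
  have hqp' : (q : ℝ) ≤ p := by exact_mod_cast hqp
  have hquot := hM.quot_pos q
  have hquotp := hM.quot_pos p
  have hq1 : 1 ≤ (q : ℝ) + 1 := by have := q.cast_nonneg (α := ℝ); linarith
  rcases le_total q₀ q with hq | hq
  · refine (hlarge' q p hq hqp).trans ?_
    rw [mul_assoc]
    exact le_mul_of_one_le_left (by positivity) hq₀1
  · rcases le_total q₀ p with hp | hp
    · calc (((p : ℝ) + 1) / (q + 1)) ^ α * quot M q
          ≤ (((q₀ : ℝ) + 1) * (((p : ℝ) + 1) / (q₀ + 1))) ^ α * quot M q₀ := by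
            gcongr ?_ ^ α * ?_
            · rw [mul_div_cancel₀ _ (by positivity)]
              exact div_le_self (by positivity) hq1
            · exact hM.quot_mono hq
        _ = ((q₀ : ℝ) + 1) ^ α * ((((p : ℝ) + 1) / (q₀ + 1)) ^ α * quot M q₀) := by
            rw [Real.mul_rpow (by positivity) (by positivity), mul_assoc]
        _ ≤ ((q₀ : ℝ) + 1) ^ α * (G₀ * quot M p) := 
            mul_le_mul_of_nonneg_left (hlarge' q₀ p le_rfl hp) (by positivity)
        _ = _ := by ring
    · have hp' : (p : ℝ) ≤ q₀ := by exact_mod_cast hp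
      calc (((p : ℝ) + 1) / (q + 1)) ^ α * quot M q ≤ ((q₀ : ℝ) + 1) ^ α * quot M p := by
            gcongr ?_ ^ α * ?_
            · exact (div_le_self (by positivity) hq1).trans (by linarith)
            · exact hM.quot_mono hqp
        _ ≤ _ := by
          gcongr
          exact le_mul_of_one_le_right (by positivity) hG₀

end ModerateGrowth

end LCseq

/-- Multiplying the normalized quotients of a sequence by a slowly decreasing sequence keeps
two-sided power growth. -/
lemma powerGrowth_mul_quot {M ε : ℕ → ℝ} (hM : LCseq M) {B : ℕ} {D G α δ : ℝ} (hG : 1 ≤ G)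
    (hlower : ∀ q p : ℕ, q ≤ p → (((p : ℝ) + 1) / (q + 1)) ^ α * quot M q ≤ G * quot M p)
    (hupper : ∀ q p : ℕ, q ≤ p →
      quot M p ≤ D * (((p : ℝ) + 1) / (q + 1)) ^ B * quot M q)
    (hε : ∀ k, 0 < ε k) (hanti : Antitone ε)
    (hslow : ∀ q p : ℕ, q ≤ p → ε q ≤ (((p : ℝ) + 1) / (q + 1)) ^ δ * ε p) :
    PowerGrowth (fun q => ε q * quot M q / ((q : ℝ) + 1)) G⁻¹ (α - δ - 1) D B where
  pos q := by have := hε q; have := hM.quot_pos q; positivity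
  c_pos := by positivity
  c_le_one := inv_le_one_of_one_le₀ hG
  lower q p hqp := by
    have h1 := hlower q p hqp
    have h2 := hslow q p hqp
    have hεp := hε p
    have hεq := hε q
    have hq := hM.quot_pos q
    have hp := hM.quot_pos p
    set y : ℝ := ((p : ℝ) + 1) / (q + 1) with hy_def
    have hy : 0 < y := by positivity
    have hyδ : 0 < y ^ δ := by positivity
    have hp1 : (p : ℝ) + 1 = y * (q + 1) := by rw [hy_def]; field_simp
    rw [Real.rpow_sub hy, Real.rpow_sub hy, Real.rpow_one, hp1]
    have h3 : (y ^ α * quot M q) * ε q ≤ (G * quot M p) * (y ^ δ * ε p) := by gcongr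
    rw [← sub_nonneg] at h3 ⊢
    have hrew : ε p * quot M p / (y * (q + 1)) -
        G⁻¹ * (y ^ α / y ^ δ / y) * (ε q * quot M q / (q + 1)) =
        (G * quot M p * (y ^ δ * ε p) - y ^ α * quot M q * ε q) / (G * y ^ δ * y * (q + 1)) := by
      field_simp
    rw [hrew]
    positivity
  upper q p hqp := by
    have h1 := hupper q p hqp
    have hqp' : (q : ℝ) ≤ p := by exact_mod_cast hqp
    have hεp := hε p
    have hεq := hε q
    have hq := hM.quot_pos q
    have hp := hM.quot_pos p
    have h2 := hanti hqp
    calc ε p * quot M p / ((p : ℝ) + 1)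
        ≤ ε q * (D * (((p : ℝ) + 1) / (q + 1)) ^ B * quot M q) / ((q : ℝ) + 1) := by
          have := hp.le.trans h1
          gcongr
      _ = _ := by ring

/-- Beurling case, weight sequences: surjectivity of the Borel map
on the Beurling class `A_{(M̂)}(S_γ)` for `0 < γ < min(2, γ(ω_{M̂}) − 1)`. -/
theorem beurling_borel_surjective_weight_sequence
    (M : ℕ → ℝ) (Mhat : ℕ → ℝ)
    (hMhat : ∀ p : ℕ, Mhat p = (Nat.factorial p : ℝ) * M p)
    (hLC : LCseq Mhat)
    (hmg : ∃ C : ℝ, 1 ≤ C ∧ ∀ j k : ℕ, Mhat (j + k) ≤ C ^ (j + k) * Mhat j * Mhat k)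
    (hγω : 1 < gammaIndex (assocWeight Mhat))
    (γ : ℝ) (hγ0 : 0 < γ)
    (hγ : ENNReal.ofReal γ < min 2 (gammaIndex (assocWeight Mhat) - 1))
    (lam : ℕ → ℂ)
    (hlam : ∀ h : ℝ, 0 < h → ∃ A : ℝ, ∀ p : ℕ, ‖lam p‖ ≤ A * h ^ p * Mhat p) :
    ∃ f : ℂ → ℂ, DifferentiableOn ℂ f (sector γ) ∧
      (∀ h : ℝ, 0 < h → ∃ C : ℝ, ∀ z ∈ sector γ, ∀ p : ℕ,
        ‖iteratedDeriv p f z‖ ≤ C * h ^ p * Mhat p) ∧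
      (∀ p : ℕ, Filter.Tendsto (iteratedDeriv p f)
        (nhdsWithin 0 (sector γ)) (nhds (lam p))) := by
  obtain ⟨C, hC, hmg⟩ := hmg
  have hγ2 : γ < 2 := by
    have h1 := hγ.trans_le (min_le_left _ _)
    rw [← ENNReal.ofReal_ofNat, ENNReal.ofReal_lt_ofReal_iff two_pos] at h1
    exact h1
  obtain ⟨α, hα1, hP⟩ : ∃ α, γ + 1 < α ∧ Pcond (assocWeight Mhat) α := by
    have h1 : ENNReal.ofReal (γ + 1) < gammaIndex (assocWeight Mhat) := by
      rw [ENNReal.ofReal_add hγ0.le zero_le_one, ENNReal.ofReal_one]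
      exact lt_tsub_iff_right.1 (hγ.trans_le (min_le_right _ _))
    simp only [gammaIndex, lt_iSup_iff] at h1
    obtain ⟨α, ⟨hα0, hP⟩, hα⟩ := h1
    exact ⟨α, (ENNReal.ofReal_lt_ofReal_iff hα0).1 hα, hP⟩
  obtain ⟨G, hG, hlower⟩ := hLC.exists_le_quot hC hmg (by linarith) hP
  obtain ⟨B, hupper⟩ := hLC.exists_quot_le hC hmg
  have hMpos := hLC.1
  obtain ⟨ε, hε, hanti, hslow, hε0, hprod⟩ :=
    exists_slowly_decreasing_prod_majorant (r := fun p => ‖lam p‖ / Mhat p)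
      (fun p => by have := hMpos p; positivity)
      (fun h hh => by
        obtain ⟨A, hA⟩ := hlam h hh
        exact ⟨A, fun p => (div_le_iff₀ (hMpos p)).2 (hA p)⟩)
      (δ := (α - 1 - γ) / 2) (by linarith)
  have hgrowth := powerGrowth_mul_quot hLC hG hlower hupper hε hanti hslow
  have hN : ∀ p : ℕ, (p.factorial : ℝ) * ∏ q ∈ Finset.range p, ε q * quot Mhat q / ((q : ℝ) + 1) =
      (∏ q ∈ Finset.range p, ε q) * Mhat p := fun p => by
    have h1 : ∏ q ∈ Finset.range p, ((q : ℝ) + 1) = p.factorial := by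
      rw [← Finset.prod_range_add_one_eq_factorial]; push_cast; rfl
    rw [Finset.prod_div_distrib, Finset.prod_mul_distrib, hLC.prod_quot, h1,
      mul_div_cancel₀ _ (by exact_mod_cast p.factorial_ne_zero)]
  set A : ℝ := max 1 ‖lam 0‖ with hA_def
  have hA1 : 1 ≤ A := le_max_left _ _
  obtain ⟨C', hC', f, hf, hbound, hlim⟩ := hgrowth.exists_derivatives_at_vertex hγ0 hγ2
    (by linarith) (lam := lam) (A := A) (by linarith) (fun p => by
      rw [hN]
      cases p with
      | zero => simp [hLC.2.1, hA_def]
      | succ p =>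
        have h1 := (div_le_iff₀ (hMpos _)).1 (hprod p)
        exact h1.trans (le_mul_of_one_le_left ((norm_nonneg _).trans h1) hA1))
  refine ⟨f, hf, fun h hh => ?_, hlim⟩
  obtain ⟨E, hE⟩ := exists_prod_le_mul_pow hε hε0 (div_pos hh hC')
  refine ⟨3 * A * E, fun z hz p => (hbound z hz p).trans ?_⟩
  have hp := hMpos p
  rw [hN]
  calc 3 * A * (C' ^ p * ((∏ q ∈ Finset.range p, ε q) * Mhat p))
      ≤ 3 * A * (C' ^ p * (E * (h / C') ^ p * Mhat p)) := by gcongr; exact hE p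
    _ = _ := by rw [div_pow]; field_simp
end

section
/- Let ω ∈ W_0 satisfy (ω_1) and (ω_5) and γ((ω⋆)^ι) > 0, and let 0 < γ < min(2, γ((ω⋆)^ι)). Then there exists a family (G_a)_{a>0} of nowhere-vanishing holomorphic functions on S_γ satisfying the two-sided bound K₁^{−a} exp(−2a ω⋆(K₂|ξ|)) ≤ |G_a(ξ)| ≤ exp(−(a/2) ω⋆(K₃|ξ|)) on S_γ (with K₁,K₂,K₃ depending only on ω, γ), such that moreover: (1) for every a > 0 there exist E₁, E₂ > 0 with |G_a^{(j)}(ξ)| ≤ E₁^{j+1} W^{4/a}_j h_{w^{4/a}}(E₂|ξ|) for all ξ ∈ S_γ and j ∈ ℕ; and (2) for every y > 0 there exist x > 0, a > 0 and E₃, E₄, E₅ > 0 with |(1/G_a)^{(j)}(ξ)| ≤ E₃ E₄^j W^x_j / h_{w^y}(E₅|ξ|) for all ξ ∈ S_γ and j ∈ ℕ. -/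
open Filter MeasureTheory Set Asymptotics

section Conjugates

variable {ω : ℝ → ℝ}

lemma InW0.nonneg (hω : InW0 ω) {t : ℝ} (ht : 0 ≤ t) : 0 ≤ ω t := by
  have := hω.1.monotoneOn (Set.mem_Ici.2 le_rfl) (Set.mem_Ici.2 ht) ht
  rwa [hω.1.map_zero] at this

lemma InW0.eventually_mul_log_le (hω : InW0 ω) (x : ℝ) :
    ∀ᶠ t : ℝ in atTop, x * Real.log t ≤ ω t := by
  have h := hω.2.2.1.def (c := 1 / (|x| + 1)) (by positivity)
  filter_upwards [h, eventually_ge_atTop 1] with t ht h1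
  rw [Real.norm_eq_abs, Real.norm_eq_abs, abs_of_nonneg (Real.log_nonneg h1),
    abs_of_nonneg (hω.nonneg (by linarith)), one_div, inv_mul_eq_div,
    le_div_iff₀ (by positivity)] at ht
  have := Real.log_nonneg h1
  nlinarith [le_abs_self x]

lemma bddAbove_phiStar (hω : InW0 ω) (x : ℝ) :
    BddAbove ((fun y : ℝ => x * y - ω (Real.exp y)) '' Set.Ici 0) := by
  obtain ⟨Y, hY⟩ := eventually_atTop.1
    (Real.tendsto_exp_atTop.eventually (hω.eventually_mul_log_le x))
  refine ⟨|x| * |Y|, ?_⟩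
  rintro _ ⟨y, hy, rfl⟩
  have hy0 : (0 : ℝ) ≤ y := hy
  have hn := hω.nonneg (Real.exp_pos y).le
  rcases le_total Y y with h | h
  · have := hY y h
    rw [Real.log_exp] at this
    have : 0 ≤ |x| * |Y| := by positivity
    dsimp only
    linarith
  · have : x * y ≤ |x| * |Y| :=
      mul_le_mul (le_abs_self x) (h.trans (le_abs_self Y)) hy0 (abs_nonneg x)
    dsimp only
    linarith

lemma le_phiStar (hω : InW0 ω) (x : ℝ) {y : ℝ} (hy : 0 ≤ y) :
    x * y - ω (Real.exp y) ≤ phiStar ω x :=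
  le_csSup (bddAbove_phiStar hω x) ⟨y, hy, rfl⟩

lemma phiStar_le {x B : ℝ} (h : ∀ y, 0 ≤ y → x * y - ω (Real.exp y) ≤ B) :
    phiStar ω x ≤ B := by
  refine csSup_le ⟨_, 0, Set.mem_Ici.2 le_rfl, rfl⟩ ?_
  rintro _ ⟨y, hy, rfl⟩
  exact h y hy

lemma Wseq_pos (l : ℝ) (j : ℕ) : 0 < Wseq ω l j := Real.exp_pos _

lemma wseq_pos (l : ℝ) (j : ℕ) : 0 < wseq ω l j :=
  div_pos (Wseq_pos l j) (by positivity)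

lemma one_le_Wseq (hω : InW0 ω) {l : ℝ} (hl : 0 < l) (j : ℕ) : 1 ≤ Wseq ω l j := by
  have h := le_phiStar hω (l * j) le_rfl
  rw [Real.exp_zero, hω.2.1 1 (by simp), mul_zero, sub_zero] at h
  exact Real.one_le_exp (by positivity)

lemma pow_mul_exp_le_Wseq (hω : InW0 ω) {l : ℝ} (hl : 0 < l) (j : ℕ) {u : ℝ} (hu : 0 < u) :
    u ^ j * Real.exp (-(1 / l) * ω u) ≤ Wseq ω l j := by
  rcases le_total 1 u with h | h
  · have h2 := le_phiStar hω (l * j) (Real.log_nonneg h)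
    rw [Real.exp_log hu] at h2
    have h3 : u ^ j = Real.exp (j * Real.log u) := by
      rw [← Real.log_pow, Real.exp_log (by positivity)]
    rw [h3, ← Real.exp_add, Wseq, Real.exp_le_exp]
    have h4 := mul_le_mul_of_nonneg_left h2 (by positivity : 0 ≤ 1 / l)
    refine le_trans (le_of_eq ?_) h4
    field_simp
    ring
  · rw [hω.2.1 u ⟨hu.le, h⟩, mul_zero, Real.exp_zero, mul_one]
    exact (pow_le_one₀ hu.le h).trans (one_le_Wseq hω hl j)

lemma Wseq_zero_le (hω : InW0 ω) {l : ℝ} (hl : 0 < l) : Wseq ω l 0 ≤ 1 := by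
  have h : phiStar ω (l * (0 : ℕ)) ≤ 0 := phiStar_le fun y _ => by
    have := hω.nonneg (Real.exp_pos y).le
    simp only [Nat.cast_zero, mul_zero, zero_mul]
    linarith
  rw [Wseq, Real.exp_le_one_iff]
  exact mul_nonpos_of_nonneg_of_nonpos (by positivity) h

lemma bddBelow_hFun_wseq (l : ℝ) {t : ℝ} (ht : 0 ≤ t) :
    BddBelow (Set.range fun k : ℕ => wseq ω l k * t ^ k) :=
  ⟨0, by rintro _ ⟨k, rfl⟩; have := wseq_pos (ω := ω) l k; positivity⟩

lemma hFun_wseq_le (l : ℝ) {t : ℝ} (ht : 0 ≤ t) (k : ℕ) :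
    hFun (wseq ω l) t ≤ wseq ω l k * t ^ k :=
  ciInf_le (bddBelow_hFun_wseq l ht) k

lemma bddAbove_upperConj (hω : InW0 ω) (h5 : Omega5 ω) {s : ℝ} (hs : 0 < s) :
    BddAbove ((fun t : ℝ => ω t - s * t) '' Set.Ici 0) := by
  obtain ⟨T, hT⟩ := eventually_atTop.1 (h5.def hs)
  refine ⟨ω |T|, ?_⟩
  rintro _ ⟨t, ht, rfl⟩
  have ht0 : (0 : ℝ) ≤ t := ht
  have hn := hω.nonneg (abs_nonneg T)
  dsimp only
  rcases le_total T t with h | h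
  · have := hT t h
    rw [Real.norm_eq_abs, Real.norm_eq_abs, abs_of_nonneg (hω.nonneg ht0),
      abs_of_nonneg ht0] at this
    linarith
  · have := hω.1.monotoneOn ht (Set.mem_Ici.2 (abs_nonneg T)) (h.trans (le_abs_self T))
    nlinarith

lemma le_upperConj (hω : InW0 ω) (h5 : Omega5 ω) {s : ℝ} (hs : 0 < s) {t : ℝ} (ht : 0 ≤ t) :
    ω t - s * t ≤ upperConj ω s :=
  le_csSup (bddAbove_upperConj hω h5 hs) ⟨t, ht, rfl⟩

lemma upperConj_le {s B : ℝ} (h : ∀ t, 0 ≤ t → ω t - s * t ≤ B) : upperConj ω s ≤ B := by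
  refine csSup_le ⟨_, 0, Set.mem_Ici.2 le_rfl, rfl⟩ ?_
  rintro _ ⟨t, ht, rfl⟩
  exact h t ht

lemma upperConj_nonneg (hω : InW0 ω) (h5 : Omega5 ω) {s : ℝ} (hs : 0 < s) :
    0 ≤ upperConj ω s := by
  have := le_upperConj hω h5 hs le_rfl
  rwa [hω.1.map_zero, mul_zero, sub_zero] at this

lemma upperConj_anti (hω : InW0 ω) (h5 : Omega5 ω) {s s' : ℝ} (hs : 0 < s) (h : s ≤ s') :
    upperConj ω s' ≤ upperConj ω s :=
  upperConj_le fun t ht => by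
    have := le_upperConj hω h5 hs ht
    nlinarith

lemma exists_upperConj_eq_zero (hω : InW0 ω) (h5 : Omega5 ω) :
    ∃ A : ℝ, 0 < A ∧ ∀ s, A ≤ s → upperConj ω s = 0 := by
  refine ⟨upperConj ω 1 + 1, by linarith [upperConj_nonneg hω h5 one_pos], fun s hs => ?_⟩
  have h0 := upperConj_nonneg hω h5 one_pos
  refine le_antisymm (upperConj_le fun t ht => ?_) (upperConj_nonneg hω h5 (by linarith))
  rcases le_total t 1 with h | h
  · rw [hω.2.1 t ⟨ht, h⟩]
    nlinarith
  · have := le_upperConj hω h5 one_pos ht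
    nlinarith

lemma eventually_upperConjIota_pos (hω : InW0 ω) (h5 : Omega5 ω) :
    ∀ᶠ t : ℝ in atTop, 0 < upperConjIota ω t := by
  obtain ⟨u, hu0, hu⟩ :=
    ((eventually_ge_atTop (0 : ℝ)).and (hω.1.tendsto_atTop.eventually_ge_atTop 2)).exists
  filter_upwards [eventually_ge_atTop u, eventually_gt_atTop 0] with t ht ht0
  rw [upperConjIota, if_neg ht0.ne']
  have := le_upperConj hω h5 (one_div_pos.2 ht0) hu0
  have h2 : 1 / t * u ≤ 1 := by
    rw [one_div_mul_eq_div]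
    exact div_le_one_of_le₀ ht ht0.le
  linarith

lemma exists_upperConj_eq (hω : InW0 ω) (h5 : Omega5 ω) {s : ℝ} (hs : 0 < s) :
    ∃ v : ℝ, 0 ≤ v ∧ upperConj ω s = ω v - s * v := by
  obtain ⟨T, hT⟩ := eventually_atTop.1 (h5.def hs)
  have hc : ContinuousOn (fun t : ℝ => ω t - s * t) (Set.Icc 0 |T|) :=
    (hω.1.continuousOn.mono Set.Icc_subset_Ici_self).sub (by fun_prop)
  obtain ⟨v, hv, hmax⟩ := isCompact_Icc.exists_isMaxOn ⟨0, by simp⟩ hc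
  refine ⟨v, hv.1, le_antisymm (upperConj_le fun t ht => ?_) (le_upperConj hω h5 hs hv.1)⟩
  rcases le_total t |T| with h | h
  · exact hmax ⟨ht, h⟩
  · have h0 : ω 0 - s * 0 ≤ ω v - s * v := hmax (by simp : (0 : ℝ) ∈ Set.Icc 0 |T|)
    have := hT t ((le_abs_self T).trans h)
    rw [Real.norm_eq_abs, Real.norm_eq_abs, abs_of_nonneg (hω.nonneg ht),
      abs_of_nonneg ht] at this
    rw [hω.1.map_zero] at h0
    linarith

lemma exp_neg_upperConj_le_wseq (hω : InW0 ω) (h5 : Omega5 ω) {l c s : ℝ} (hl : 0 < l)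
    (hc : 0 < c) (hs : 0 < s) (k : ℕ) :
    Real.exp (-(1 / l) * upperConj ω (c * s)) ≤
      wseq ω l k * (Real.exp (c / l) * s) ^ k := by
  rcases Nat.eq_zero_or_pos k with rfl | hk
  · have h0 := upperConj_nonneg hω h5 (mul_pos hc hs)
    have h1 : Real.exp (-(1 / l) * upperConj ω (c * s)) ≤ 1 := by
      rw [Real.exp_le_one_iff, neg_mul, neg_nonpos]
      positivity
    simpa [wseq] using h1.trans (one_le_Wseq hω hl 0)
  · have hk' : (0 : ℝ) < k := by exact_mod_cast hk
    have hu : 0 < (k : ℝ) / s := by positivity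
    have h1 := le_upperConj hω h5 (mul_pos hc hs) hu.le
    have h2 := pow_mul_exp_le_Wseq hω hl k hu
    have h3 : Real.exp (-(1 / l) * upperConj ω (c * s)) ≤
        Real.exp (-(1 / l) * ω (k / s)) * Real.exp (c / l) ^ k := by
      rw [← Real.exp_nat_mul, ← Real.exp_add, Real.exp_le_exp]
      have h4 := mul_le_mul_of_nonneg_left h1 (by positivity : 0 ≤ 1 / l)
      have h5 : 1 / l * (ω (k / s) - c * s * (k / s)) =
          1 / l * ω (k / s) - k * (c / l) := by
        field_simp
      linarith
    refine h3.trans ?_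
    have h4 : (1 : ℝ) ≤ (k : ℝ) ^ k / (k.factorial : ℝ) := by
      rw [one_le_div (by positivity)]
      exact_mod_cast Nat.factorial_le_pow k
    calc Real.exp (-(1 / l) * ω (k / s)) * Real.exp (c / l) ^ k
        ≤ Real.exp (-(1 / l) * ω (k / s)) * Real.exp (c / l) ^ k *
          ((k : ℝ) ^ k / (k.factorial : ℝ)) := le_mul_of_one_le_right (by positivity) h4
      _ = ((k / s) ^ k * Real.exp (-(1 / l) * ω (k / s))) / k.factorial *
          (Real.exp (c / l) * s) ^ k := by
        rw [div_pow, mul_pow]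
        field_simp
      _ ≤ wseq ω l k * (Real.exp (c / l) * s) ^ k := by
        unfold wseq
        gcongr

lemma exp_neg_upperConj_le_hFun (hω : InW0 ω) (h5 : Omega5 ω) {l c s : ℝ} (hl : 0 < l)
    (hc : 0 < c) (hs : 0 < s) :
    Real.exp (-(1 / l) * upperConj ω (c * s)) ≤
      hFun (wseq ω l) (Real.exp (c / l) * s) :=
  le_ciInf fun k => exp_neg_upperConj_le_wseq hω h5 hl hc hs k

lemma hFun_wseq_pos (hω : InW0 ω) (h5 : Omega5 ω) {l t : ℝ} (hl : 0 < l) (ht : 0 < t) :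
    0 < hFun (wseq ω l) t := by
  have h := exp_neg_upperConj_le_hFun hω h5 hl one_pos
    (mul_pos (Real.exp_pos (-(1 / l))) ht)
  rw [← mul_assoc (Real.exp (1 / l)), ← Real.exp_add, add_neg_cancel, Real.exp_zero,
    one_mul t] at h
  exact (Real.exp_pos _).trans_le h

lemma factorial_div_pow_mul_exp_le_Wseq (hω : InW0 ω) (h5 : Omega5 ω) {l c s : ℝ} (hl : 0 < l)
    (hc : 0 < c) (hs : 0 < s) (k : ℕ) :
    (k.factorial : ℝ) / s ^ k * Real.exp (-(1 / l) * upperConj ω (c * s)) ≤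
      Real.exp (c / l) ^ k * Wseq ω l k := by
  have h := exp_neg_upperConj_le_wseq hω h5 hl hc hs k
  calc (k.factorial : ℝ) / s ^ k * Real.exp (-(1 / l) * upperConj ω (c * s))
      ≤ (k.factorial : ℝ) / s ^ k * (wseq ω l k * (Real.exp (c / l) * s) ^ k) := by gcongr
    _ = Real.exp (c / l) ^ k * Wseq ω l k := by
      rw [wseq, mul_pow]
      field_simp

lemma mul_sub_le_of_convexOn_of_monotone {φ : ℝ → ℝ} (hφ : ConvexOn ℝ Set.univ φ)
    (hm : Monotone φ) (x₀ x : ℝ) :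
    (φ x₀ - φ (x₀ - 1)) * x - φ x ≤ (φ x₀ - φ (x₀ - 1)) * (x₀ + 1) - φ x₀ := by
  have h0 : φ (x₀ - 1) ≤ φ x₀ := hm (by linarith)
  rcases lt_or_ge x₀ x with h | h
  · have := hφ.slope_mono_adjacent (Set.mem_univ (x₀ - 1)) (Set.mem_univ x)
      (by linarith : x₀ - 1 < x₀) h
    rw [sub_sub_cancel, div_one, le_div_iff₀ (by linarith)] at this
    linarith
  · rcases lt_or_ge x (x₀ - 1) with h' | h'
    · have := hφ.slope_mono_adjacent (Set.mem_univ x) (Set.mem_univ x₀) h'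
        (by linarith : x₀ - 1 < x₀)
      rw [sub_sub_cancel, div_one, div_le_iff₀ (by linarith)] at this
      linarith
    · have := hm h'
      nlinarith

lemma hFun_wseq_le_exp_neg_upperConj (hω : InW0 ω) (h5 : Omega5 ω) {y : ℝ} (hy : 0 < y) :
    ∃ C B : ℝ, 0 < C ∧ 0 < B ∧ ∀ t, 0 < t →
      hFun (wseq ω y) t ≤ C * Real.exp (-(1 / (2 * y)) * upperConj ω (B * t)) := by
  obtain ⟨T, hT⟩ := eventually_atTop.1 (hω.eventually_mul_log_le (2 * y))
  set T' := max T (Real.exp 2) with hT'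
  have hT0 : 0 ≤ T' := (Real.exp_pos 2).le.trans (le_max_right _ _)
  have hC : 1 ≤ Real.exp (1 / (2 * y) * ω T') :=
    Real.one_le_exp (by have := hω.nonneg hT0; positivity)
  refine ⟨Real.exp (1 / (2 * y) * ω T'), 4 * Real.exp 1 ^ 2 * y, by positivity, by positivity,
    fun t ht => ?_⟩
  set s := 4 * Real.exp 1 ^ 2 * y * t with hs
  have hs0 : 0 < s := by positivity
  have hle1 : hFun (wseq ω y) t ≤ 1 := by
    have := hFun_wseq_le (ω := ω) y ht.le 0
    simp only [wseq, Nat.factorial_zero, Nat.cast_one, div_one, pow_zero, mul_one] at this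
    exact this.trans (Wseq_zero_le hω hy)
  obtain ⟨v, hv0, hv⟩ := exists_upperConj_eq hω h5 hs0
  have hup := upperConj_nonneg hω h5 hs0
  rcases le_or_gt v T' with hvT | hvT
  · refine hle1.trans ?_
    rw [← Real.exp_add]
    refine Real.one_le_exp ?_
    have : upperConj ω s ≤ ω T' := by
      have := hω.1.monotoneOn (Set.mem_Ici.2 hv0) (Set.mem_Ici.2 hT0) hvT
      nlinarith
    have := mul_le_mul_of_nonneg_left this (by positivity : 0 ≤ 1 / (2 * y))
    linarith
  have hvpos : 0 < v := hT0.trans_lt hvT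
  set x₀ := Real.log v with hx₀
  have hx₀2 : 2 < x₀ := by
    rw [hx₀, Real.lt_log_iff_exp_lt hvpos]
    exact (le_max_right _ _).trans_lt hvT
  have hmono : Monotone fun x : ℝ => ω (Real.exp x) := fun a b hab =>
    hω.1.monotoneOn (Real.exp_pos a).le (Real.exp_pos b).le (Real.exp_le_exp.2 hab)
  have hsub := mul_sub_le_of_convexOn_of_monotone hω.2.2.2 hmono x₀
  have hexp : Real.exp x₀ = v := Real.exp_log hvpos
  rw [hexp] at hsub
  set m := ω v - ω (Real.exp (x₀ - 1)) with hm
  have hm1 : s * v / 2 ≤ m := by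
    have h := le_upperConj hω h5 hs0 (Real.exp_pos (x₀ - 1)).le
    rw [hv] at h
    have h2 : Real.exp (x₀ - 1) ≤ v / 2 := by
      rw [Real.exp_sub, hexp]
      have := Real.add_one_le_exp (1 : ℝ)
      gcongr
      linarith
    nlinarith
  have hm0 : 0 < m := lt_of_lt_of_le (by positivity) hm1
  have hmy : y ≤ m := by
    by_contra! hlt
    have h0 := hsub 0
    rw [Real.exp_zero, hω.2.1 1 (by simp)] at h0
    have h3 := hT v ((le_max_left _ _).trans hvT.le)
    nlinarith
  set k := ⌊m / y⌋₊ with hk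
  have hk1 : 1 ≤ k := Nat.le_floor (by rw [Nat.cast_one, one_le_div hy]; exact hmy)
  have hkR : (1 : ℝ) ≤ k := by exact_mod_cast hk1
  have hkle : (k : ℝ) * y ≤ m := by
    rw [← le_div_iff₀ hy]
    exact Nat.floor_le (by positivity)
  have hkge : m ≤ 2 * y * k := by
    have := Nat.lt_floor_add_one (m / y)
    rw [div_lt_iff₀ hy, ← hk] at this
    nlinarith
  have hphi : phiStar ω (y * k) ≤ y * k * (x₀ + 1) - y * k / m * ω v := by
    refine phiStar_le fun x hx => ?_
    have hθ : y * k / m ≤ 1 := div_le_one_of_le₀ (by linarith) hm0.le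
    have h1 := mul_le_mul_of_nonneg_left (hsub x) (by positivity : 0 ≤ y * k / m)
    have h2 : y * k / m * (m * x - ω (Real.exp x)) =
        y * k * x - y * k / m * ω (Real.exp x) := by
      field_simp
    have h3 : y * k / m * (m * (x₀ + 1) - ω v) =
        y * k * (x₀ + 1) - y * k / m * ω v := by
      field_simp
    have h4 := hω.nonneg (Real.exp_pos x).le
    nlinarith
  have hW : Wseq ω y k ≤ (Real.exp 1 * v) ^ k * Real.exp (-(1 / (2 * y)) * ω v) := by
    have h1 : Real.exp 1 * v = Real.exp (x₀ + 1) := by rw [Real.exp_add, hexp, mul_comm]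
    rw [h1, ← Real.exp_nat_mul, ← Real.exp_add, Wseq, Real.exp_le_exp]
    have h2 := mul_le_mul_of_nonneg_left hphi (by positivity : 0 ≤ 1 / y)
    have h3 : 1 / y * (y * k * (x₀ + 1) - y * k / m * ω v) =
        k * (x₀ + 1) - k / m * ω v := by
      field_simp
    have h4 : 1 / (2 * y) ≤ k / m := by
      rw [div_le_div_iff₀ (by positivity) hm0]
      linarith
    have h5 := mul_le_mul_of_nonneg_right h4 (hω.nonneg hv0)
    linarith
  have hfac : (Real.exp 1 * v * t) ^ k / (k.factorial : ℝ) ≤ 1 := by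
    have hE := Real.exp_pos 1
    have h1 : Real.exp 1 * v * t ≤ k / Real.exp 1 := by
      rw [le_div_iff₀ hE]
      have : s * v / 2 ≤ 2 * y * k := hm1.trans hkge
      rw [hs] at this
      have h2 : 2 * y * (Real.exp 1 * v * t * Real.exp 1) ≤ 2 * y * k := by linarith
      exact le_of_mul_le_mul_left h2 (by positivity)
    have h2 := Real.pow_div_factorial_le_exp k (by positivity) k
    calc (Real.exp 1 * v * t) ^ k / (k.factorial : ℝ)
        ≤ (k / Real.exp 1) ^ k / (k.factorial : ℝ) := by gcongr
      _ = (k : ℝ) ^ k / (k.factorial : ℝ) / Real.exp k := by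
        rw [div_pow, ← Real.exp_nat_mul, mul_one]
        field_simp
      _ ≤ 1 := div_le_one_of_le₀ h2 (Real.exp_pos _).le
  calc hFun (wseq ω y) t ≤ wseq ω y k * t ^ k := hFun_wseq_le y ht.le k
    _ ≤ (Real.exp 1 * v) ^ k * Real.exp (-(1 / (2 * y)) * ω v) / k.factorial * t ^ k := by
      unfold wseq
      gcongr
    _ = Real.exp (-(1 / (2 * y)) * ω v) * ((Real.exp 1 * v * t) ^ k / (k.factorial : ℝ)) := by
      rw [mul_pow (Real.exp 1 * v) t]
      field_simp
    _ ≤ Real.exp (-(1 / (2 * y)) * ω v) * 1 := by gcongr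
    _ ≤ Real.exp (-(1 / (2 * y)) * upperConj ω s) := by
      rw [mul_one, Real.exp_le_exp, neg_mul, neg_mul, neg_le_neg_iff]
      have : upperConj ω s ≤ ω v := by nlinarith
      gcongr
    _ ≤ Real.exp (1 / (2 * y) * ω T') * Real.exp (-(1 / (2 * y)) * upperConj ω s) :=
      le_mul_of_one_le_left (Real.exp_pos _).le hC

end Conjugates

section HalfPlane

lemma div_add_ofReal_bounds {w : ℂ} (hw : 0 < w.re) {t : ℝ} (ht : 0 < t) :
    0 ≤ (w / (w + t)).re ∧ (w / (w + t)).re ≤ 1 ∧ ‖w / (w + t)‖ ≤ ‖w‖ / t ∧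
      (t ≤ ‖w‖ → 1 / 2 ≤ (w / (w + t)).re) := by
  have hN : 0 < Complex.normSq (w + t) := by
    rw [Complex.normSq_pos]
    intro h
    have := congrArg Complex.re h
    simp at this
    linarith
  have hre : (w / (w + t)).re = (w.re * (w.re + t) + w.im * w.im) / Complex.normSq (w + t) := by
    simp [Complex.div_re]
    ring
  have hns : Complex.normSq (w + t) = (w.re + t) * (w.re + t) + w.im * w.im := by
    simp [Complex.normSq_apply]
  refine ⟨?_, ?_, ?_, fun h => ?_⟩
  · rw [hre]
    exact div_nonneg (by nlinarith [mul_self_nonneg w.im]) hN.le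
  · rw [hre, div_le_one hN, hns]
    nlinarith
  · rw [norm_div]
    have : t ≤ ‖w + t‖ := by
      refine le_trans ?_ (Complex.re_le_norm _)
      simp
      exact hw.le
    gcongr
  · have h2 : t ^ 2 ≤ w.re ^ 2 + w.im ^ 2 := by
      have h3 := Complex.sq_norm w
      rw [Complex.normSq_apply] at h3
      nlinarith
    rw [hre, div_le_div_iff₀ two_pos hN, hns]
    nlinarith

/-- A holomorphic function on the right half-plane whose real part is comparable to a radial
weight `τ` that grows at infinity like a power of exponent less than one. -/
lemma exists_holomorphic_re_comparable {τ : ℝ → ℝ} (hmono : MonotoneOn τ (Set.Ioi 0))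
    (hzero : ∀ t, 0 < t → t ≤ 1 → τ t = 0) {K c : ℝ} (hK : 1 < K) (hcK : c < K)
    (hgrow : ∀ᶠ t in atTop, τ (K * t) ≤ c * τ t) :
    ∃ (F : ℂ → ℂ) (D C : ℝ), 0 < D ∧ 0 ≤ C ∧ DifferentiableOn ℂ F {w | 0 < w.re} ∧
      ∀ w : ℂ, 0 < w.re → 1 / 2 * τ ‖w‖ ≤ (F w).re ∧ (F w).re ≤ 2 * τ (D * ‖w‖) + C := by
  have hK0 : 0 < K := one_pos.trans hK
  have hnonneg : ∀ t, 0 < t → 0 ≤ τ t := fun t ht => by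
    have h := hmono (Set.mem_Ioi.2 (lt_min ht one_pos)) (Set.mem_Ioi.2 ht) (min_le_left t 1)
    rwa [hzero _ (lt_min ht one_pos) (min_le_right t 1)] at h
  set a : ℕ → ℝ := fun n => τ (K ^ n) with ha
  have ha0 : ∀ n, 0 ≤ a n := fun n => hnonneg _ (by positivity)
  have ha_zero : a 0 = 0 := by simp [ha, hzero 1 one_pos le_rfl]
  have ha_mono : Monotone a := fun m n hmn =>
    hmono (Set.mem_Ioi.2 (by positivity)) (Set.mem_Ioi.2 (by positivity))
      (pow_le_pow_right₀ hK.le hmn)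
  set d : ℕ → ℝ := fun n => a (n + 1) - a n with hd
  have hd0 : ∀ n, 0 ≤ d n := fun n => sub_nonneg.2 (ha_mono n.le_succ)
  have hsum_d : ∀ M, ∑ n ∈ Finset.range M, d n = a M := fun M => by
    rw [hd, Finset.sum_range_sub, ha_zero, sub_zero]
  obtain ⟨c', hc'1, hc'K, hc'⟩ : ∃ c', 1 ≤ c' ∧ c' < K ∧ ∀ᶠ n in atTop, a (n + 1) ≤ c' * a n := by
    refine ⟨max c 1, le_max_right _ _, max_lt hcK hK, ?_⟩
    filter_upwards [(tendsto_pow_atTop_atTop_of_one_lt hK).eventually hgrow] with n hn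
    have h1 : a (n + 1) = τ (K * K ^ n) := by simp only [ha, pow_succ']
    rw [h1]
    exact hn.trans (mul_le_mul_of_nonneg_right (le_max_left _ _) (ha0 n))
  obtain ⟨n₁, hn₁⟩ := eventually_atTop.1 hc'
  have ha_pow : ∀ M, n₁ ≤ M → ∀ j, a (M + j) ≤ c' ^ j * a M := fun M hM j => by
    induction j with
    | zero => simp
    | succ j ih =>
      calc a (M + (j + 1)) ≤ c' * a (M + j) := hn₁ (M + j) (by omega)
        _ ≤ c' * (c' ^ j * a M) := by gcongr
        _ = c' ^ (j + 1) * a M := by ring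
  have hc'0 : 0 < c' := one_pos.trans_le hc'1
  set ρ := c' / K with hρ
  have hρ0 : 0 ≤ ρ := by positivity
  have hρ1 : ρ < 1 := (div_lt_one hK0).2 hc'K
  have hd_le : ∀ M, n₁ ≤ M → ∀ j, d (M + j) / K ^ j ≤ c' * a M * ρ ^ j := fun M hM j => by
    have h1 : d (M + j) ≤ c' ^ (j + 1) * a M :=
      (sub_le_self _ (ha0 _)).trans (ha_pow M hM (j + 1))
    calc d (M + j) / K ^ j ≤ c' ^ (j + 1) * a M / K ^ j := by gcongr
      _ = c' * a M * ρ ^ j := by rw [hρ, div_pow]; ring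
  have hgeo : Summable fun j : ℕ => ρ ^ j := summable_geometric_of_lt_one hρ0 hρ1
  have hsum_tail : ∀ M, n₁ ≤ M → Summable fun j => d (M + j) / K ^ j := fun M hM =>
    Summable.of_nonneg_of_le (fun j => div_nonneg (hd0 _) (by positivity)) (hd_le M hM)
      (hgeo.mul_left _)
  have hsum : Summable fun n => d n / K ^ n := by
    rw [← summable_nat_add_iff n₁]
    have := (hsum_tail n₁ le_rfl).mul_right (1 / K ^ n₁)
    refine this.congr fun j => ?_
    rw [add_comm n₁ j, pow_add]
    field_simp
  set f : ℕ → ℂ → ℂ := fun n w => d n * (w / (w + (K ^ n : ℝ))) with hf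
  have hbound : ∀ n w, 0 < w.re → ‖f n w‖ ≤ ‖w‖ * (d n / K ^ n) := fun n w hw => by
    have := (div_add_ofReal_bounds hw (by positivity : 0 < K ^ n)).2.2.1
    rw [hf, norm_mul, Complex.norm_real, Real.norm_of_nonneg (hd0 n)]
    calc d n * _ ≤ d n * (‖w‖ / K ^ n) := mul_le_mul_of_nonneg_left this (hd0 n)
      _ = _ := by ring
  have hfsum : ∀ w : ℂ, 0 < w.re → Summable fun n => f n w := fun w hw =>
    Summable.of_norm_bounded (hsum.mul_left ‖w‖) fun n => hbound n w hw
  have hre : ∀ n w, (f n w).re = d n * (w / (w + (K ^ n : ℝ))).re := fun n w => by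
    rw [hf, Complex.re_ofReal_mul]
  have hresum : ∀ w : ℂ, 0 < w.re → Summable fun n => (f n w).re := fun w hw =>
    (Complex.hasSum_re (hfsum w hw).hasSum).summable
  have hre0 : ∀ n w, 0 < w.re → 0 ≤ (f n w).re := fun n w hw => by
    rw [hre]
    exact mul_nonneg (hd0 n) (div_add_ofReal_bounds hw (by positivity)).1
  obtain ⟨p, hp⟩ : ∃ p : ℕ, c' * (1 - ρ)⁻¹ ≤ K ^ p := pow_unbounded_of_one_lt _ hK |>.imp
    fun _ h => h.le
  have hupper : ∀ N, n₁ ≤ N → ∀ w : ℂ, 0 < w.re → ‖w‖ ≤ K ^ N →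
      ∑' n, (f n w).re ≤ 2 * a (N + p) := fun N hN w hw hwN => by
    have hM : n₁ ≤ N + p := by omega
    rw [← (hresum w hw).sum_add_tsum_nat_add (N + p)]
    have h1 : ∑ n ∈ Finset.range (N + p), (f n w).re ≤ a (N + p) := by
      rw [← hsum_d]
      refine Finset.sum_le_sum fun n _ => ?_
      rw [hre]
      exact mul_le_of_le_one_right (hd0 n) (div_add_ofReal_bounds hw (by positivity)).2.1
    have h2 : ∑' j, (f (j + (N + p)) w).re ≤ a (N + p) := by
      have hterm : ∀ j, (f (j + (N + p)) w).re ≤ c' * a (N + p) / K ^ p * ρ ^ j := fun j => by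
        calc (f (j + (N + p)) w).re ≤ ‖w‖ * (d (j + (N + p)) / K ^ (j + (N + p))) :=
              (Complex.re_le_norm _).trans (hbound _ w hw)
          _ ≤ K ^ N * (d (j + (N + p)) / K ^ (j + (N + p))) :=
              mul_le_mul_of_nonneg_right hwN (div_nonneg (hd0 _) (by positivity))
          _ = d (N + p + j) / K ^ j / K ^ p := by
              rw [add_comm j, pow_add, pow_add]
              field_simp
          _ ≤ c' * a (N + p) * ρ ^ j / K ^ p := by gcongr; exact hd_le _ hM j
          _ = c' * a (N + p) / K ^ p * ρ ^ j := by ring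
      calc ∑' j, (f (j + (N + p)) w).re ≤ ∑' j, c' * a (N + p) / K ^ p * ρ ^ j :=
            Summable.tsum_le_tsum hterm ((summable_nat_add_iff (N + p)).2 (hresum w hw))
              (hgeo.mul_left _)
        _ = (c' * (1 - ρ)⁻¹) / K ^ p * a (N + p) := by
            rw [tsum_mul_left, tsum_geometric_of_lt_one hρ0 hρ1]
            ring
        _ ≤ 1 * a (N + p) := by
            gcongr
            · exact ha0 _
            · exact div_le_one_of_le₀ hp (by positivity)
        _ = a (N + p) := one_mul _
    linarith
  refine ⟨fun w => ∑' n, f n w, K ^ (p + 1), 2 * a (n₁ + p), by positivity,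
    by have := ha0 (n₁ + p); positivity, ?_, fun w hw => ?_⟩
  · intro w hw
    have hopen : IsOpen ({w : ℂ | 0 < w.re} ∩ Metric.ball 0 (‖w‖ + 1)) :=
      (isOpen_lt continuous_const Complex.continuous_re).inter Metric.isOpen_ball
    have hdiff := Complex.differentiableOn_tsum_of_summable_norm (F := f)
      (hsum.mul_left (‖w‖ + 1)) (fun n => ?_) hopen fun n z hz => ?_
    · exact ((hdiff w ⟨hw, by simp⟩).differentiableAt
        (hopen.mem_nhds ⟨hw, by simp⟩)).differentiableWithinAt
    · intro z hz
      have hz0 : z + (K ^ n : ℝ) ≠ 0 := fun h => by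
        have h1 := congrArg Complex.re h
        rw [Complex.add_re, Complex.ofReal_re, Complex.zero_re] at h1
        have h2 : 0 < z.re := hz.1
        have h3 : 0 < K ^ n := by positivity
        linarith
      have : DifferentiableAt ℂ (f n) z :=
        (differentiableAt_const _).mul (differentiableAt_id.div
          (differentiableAt_id.add (differentiableAt_const _)) hz0)
      exact this.differentiableWithinAt
    · refine (hbound n z hz.1).trans
        (mul_le_mul_of_nonneg_right ?_ (div_nonneg (hd0 n) (by positivity)))
      exact (mem_ball_zero_iff.1 hz.2).le
  · have hw0 : 0 < ‖w‖ := norm_pos_iff.2 fun h => by simp [h] at hw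
    rw [Complex.re_tsum (hfsum w hw)]
    rcases lt_or_ge ‖w‖ 1 with h | h
    · refine ⟨?_, ?_⟩
      · rw [hzero _ hw0 h.le, mul_zero]
        exact tsum_nonneg fun n => hre0 n w hw
      · have := hupper n₁ le_rfl w hw (h.le.trans (one_le_pow₀ hK.le))
        have := hnonneg (K ^ (p + 1) * ‖w‖) (by positivity)
        linarith
    · obtain ⟨n, hn, hn'⟩ := exists_nat_pow_near h hK
      refine ⟨?_, ?_⟩
      · calc 1 / 2 * τ ‖w‖ ≤ 1 / 2 * a (n + 1) := by
              gcongr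
              exact hmono hw0 (Set.mem_Ioi.2 (by positivity)) hn'.le
          _ = ∑ i ∈ Finset.range (n + 1), d i * (1 / 2) := by
              rw [← Finset.sum_mul, hsum_d, mul_comm]
          _ ≤ ∑ i ∈ Finset.range (n + 1), (f i w).re := by
              refine Finset.sum_le_sum fun i hi => ?_
              rw [hre]
              refine mul_le_mul_of_nonneg_left ?_ (hd0 i)
              refine (div_add_ofReal_bounds hw (by positivity)).2.2.2 (le_trans ?_ hn)
              exact pow_le_pow_right₀ hK.le (Nat.lt_succ_iff.1 (Finset.mem_range.1 hi))
          _ ≤ ∑' i, (f i w).re :=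
              (hresum w hw).sum_le_tsum _ fun i _ => hre0 i w hw
      · rcases le_total n₁ (n + 1) with h1 | h1
        · have h2 := hupper (n + 1) h1 w hw hn'.le
          have h3 : a (n + 1 + p) ≤ τ (K ^ (p + 1) * ‖w‖) := by
            refine hmono (Set.mem_Ioi.2 (by positivity)) (Set.mem_Ioi.2 (by positivity)) ?_
            calc K ^ (n + 1 + p) = K ^ (p + 1) * K ^ n := by rw [← pow_add]; congr 1; ring
              _ ≤ _ := by gcongr
          have := ha0 (n₁ + p)
          linarith
        · have h2 := hupper n₁ le_rfl w hw (hn'.le.trans (pow_le_pow_right₀ hK.le h1))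
          have := hnonneg (K ^ (p + 1) * ‖w‖) (by positivity)
          linarith

end HalfPlane

section Sector

lemma exists_closedBall_subset_sector_s6 {γ δ : ℝ} (hγδ : γ < δ) (hδ : δ ≤ 2) :
    ∃ ε : ℝ, 0 < ε ∧ ε < 1 ∧
      ∀ ξ ∈ sector γ, Metric.closedBall ξ (ε * ‖ξ‖) ⊆ sector δ := by
  have hpi := Real.pi_pos
  have hev : ∀ᶠ z : ℂ in nhds 1, |Complex.arg z| < (δ - γ) * Real.pi / 2 := by
    have hcont := (Complex.continuousAt_arg Complex.one_mem_slitPlane).abs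
    refine hcont.eventually_lt continuousAt_const ?_
    rw [Complex.arg_one, abs_zero]
    have := sub_pos.2 hγδ
    positivity
  obtain ⟨ε, hε, hball⟩ := Metric.eventually_nhds_iff.1 hev
  have hm : 0 < min ε 1 := lt_min hε one_pos
  have hm1 := min_le_left ε 1
  have hm2 := min_le_right ε 1
  refine ⟨min ε 1 / 2, by linarith, by linarith, ?_⟩
  rintro ξ ⟨hξ, harg⟩ z hz
  have hn : 0 < ‖ξ‖ := norm_pos_iff.2 hξ
  have hd : dist (z / ξ) 1 ≤ min ε 1 / 2 := by
    rw [Metric.mem_closedBall, dist_eq_norm] at hz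
    rw [dist_eq_norm, div_sub_one hξ, norm_div, div_le_iff₀ hn]
    exact hz
  have hq0 : z / ξ ≠ 0 := fun h => by
    rw [h, dist_zero_left, norm_one] at hd
    linarith
  have hq : |Complex.arg (z / ξ)| < (δ - γ) * Real.pi / 2 := hball (by linarith)
  have hsum : |Complex.arg ξ + Complex.arg (z / ξ)| < δ * Real.pi / 2 := by
    have := abs_add_le (Complex.arg ξ) (Complex.arg (z / ξ))
    linarith
  have hz' : ξ * (z / ξ) = z := mul_div_cancel₀ z hξ
  have hlt := abs_lt.1 hsum
  have hle : δ * Real.pi / 2 ≤ Real.pi := by nlinarith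
  rw [← hz']
  refine ⟨mul_ne_zero hξ hq0, ?_⟩
  rwa [Complex.arg_mul hξ hq0 ⟨by linarith, by linarith⟩]

lemma cpow_re_pos_of_mem_sector {γ' δ : ℝ} (hγ' : 0 < γ') (hδ : δ ≤ γ') {ξ : ℂ}
    (hξ : ξ ∈ sector δ) : 0 < (ξ ^ ((-(1 / γ') : ℝ) : ℂ)).re := by
  obtain ⟨h0, harg⟩ := hξ
  rw [Complex.cpow_def_of_ne_zero h0, Complex.exp_re, Complex.re_mul_ofReal,
    Complex.im_mul_ofReal, Complex.log_im]
  refine mul_pos (Real.exp_pos _) (Real.cos_pos_of_mem_Ioo (abs_lt.1 ?_))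
  rw [abs_mul, abs_neg, abs_of_pos (by positivity : 0 < 1 / γ'), mul_one_div,
    div_lt_iff₀ hγ']
  have := Real.pi_pos
  nlinarith

lemma norm_iteratedDeriv_le_of_sector {γ δ ε M : ℝ} (hε : 0 < ε)
    (hball : ∀ ξ ∈ sector γ, Metric.closedBall ξ (ε * ‖ξ‖) ⊆ sector δ) {f : ℂ → ℂ}
    (hf : DifferentiableOn ℂ f (sector δ)) {ξ : ℂ} (hξ : ξ ∈ sector γ)
    (hM : ∀ z ∈ sector δ, (1 - ε) * ‖ξ‖ ≤ ‖z‖ → ‖z‖ ≤ (1 + ε) * ‖ξ‖ → ‖f z‖ ≤ M) (j : ℕ) :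
    ‖iteratedDeriv j f ξ‖ ≤ (1 / ε) ^ j * ((j.factorial : ℝ) / ‖ξ‖ ^ j * M) := by
  have hn : 0 < ‖ξ‖ := norm_pos_iff.2 hξ.1
  refine (Complex.norm_iteratedDeriv_le_of_forall_mem_sphere_norm_le (C := M) j (mul_pos hε hn)
    (hf.diffContOnCl_ball (hball ξ hξ)) fun z hz => ?_).trans (le_of_eq ?_)
  · have hd : ‖z - ξ‖ = ε * ‖ξ‖ := by rwa [Metric.mem_sphere, dist_eq_norm] at hz
    refine hM z (hball ξ hξ (Metric.sphere_subset_closedBall hz)) ?_ ?_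
    · have := norm_sub_norm_le ξ z
      rw [norm_sub_rev] at this
      linarith
    · have := norm_sub_norm_le z ξ
      linarith
  · rw [mul_pow, div_pow, one_pow]
    field_simp

/-- A holomorphic function on a sector whose real part is comparable to the upper Legendre
conjugate of `ω`. -/
lemma exists_holomorphic_re_comparable_upperConj {ω : ℝ → ℝ} (hω : InW0 ω) (h5 : Omega5 ω)
    {γ' δ : ℝ} (hγ' : 0 < γ') (hP : Pcond (upperConjIota ω) γ') (hδ : δ ≤ γ') (hδ2 : δ ≤ 2) :
    ∃ (F : ℂ → ℂ) (A B C : ℝ), 0 < A ∧ 0 < B ∧ 0 ≤ C ∧ DifferentiableOn ℂ F (sector δ) ∧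
      ∀ ξ ∈ sector δ, 1 / 2 * upperConj ω (A * ‖ξ‖) ≤ (F ξ).re ∧
        (F ξ).re ≤ 2 * upperConj ω (B * ‖ξ‖) + C := by
  obtain ⟨K, hK, c, hcK, hgrow⟩ := hP
  obtain ⟨A, hA, hA0⟩ := exists_upperConj_eq_zero hω h5
  have hK0 : 0 < K := one_pos.trans hK
  set τ : ℝ → ℝ := fun t => upperConj ω (A * t ^ (-γ')) with hτ
  have hτσ : ∀ t, 0 < t → τ t = upperConjIota ω (t ^ γ' / A) := fun t ht => by
    have : t ^ γ' / A ≠ 0 := by positivity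
    simp only [upperConjIota, if_neg this, hτ, Real.rpow_neg ht.le, one_div_div]
    rw [div_eq_mul_inv]
  have hmono : MonotoneOn τ (Set.Ioi 0) := fun s hs t ht hst => by
    have hs0 : 0 < s := hs
    have ht0 : 0 < t := ht
    refine upperConj_anti hω h5 (by positivity) ?_
    have := Real.rpow_le_rpow_of_nonpos hs0 hst (neg_nonpos.2 hγ'.le)
    gcongr
  have hzero : ∀ t, 0 < t → t ≤ 1 → τ t = 0 := fun t ht ht1 => by
    refine hA0 _ (le_mul_of_one_le_right hA.le ?_)
    exact Real.one_le_rpow_of_pos_of_le_one_of_nonpos ht ht1 (neg_nonpos.2 hγ'.le)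
  have hlim : Tendsto (fun t : ℝ => t ^ γ' / A) atTop atTop :=
    (tendsto_rpow_atTop hγ').atTop_div_const hA
  have hτgrow : ∀ᶠ t in atTop, τ (K * t) ≤ c * τ t := by
    filter_upwards [hlim.eventually hgrow, hlim.eventually (eventually_upperConjIota_pos hω h5),
      eventually_gt_atTop 0] with t h1 h2 ht
    rw [hτσ t ht, hτσ (K * t) (by positivity), Real.mul_rpow hK0.le ht.le, mul_div_assoc]
    exact (div_le_iff₀ h2).1 h1
  obtain ⟨F, D, C, hD, hC, hF, hFb⟩ :=
    exists_holomorphic_re_comparable hmono hzero hK hcK hτgrow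
  have hre : ∀ ξ ∈ sector δ, 0 < (ξ ^ ((-(1 / γ') : ℝ) : ℂ)).re := fun ξ hξ =>
    cpow_re_pos_of_mem_sector hγ' hδ hξ
  refine ⟨fun ξ => F (ξ ^ ((-(1 / γ') : ℝ) : ℂ)), A, A * D ^ (-γ'), C, hA, by positivity, hC,
    ?_, fun ξ hξ => ?_⟩
  · refine hF.comp (fun ξ hξ => ?_) hre
    have hslit : ξ ∈ Complex.slitPlane := by
      refine Complex.mem_slitPlane_iff_arg.2 ⟨fun h => ?_, hξ.1⟩
      have h2 := hξ.2
      rw [h, abs_of_pos Real.pi_pos] at h2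
      nlinarith [Real.pi_pos]
    exact (differentiableAt_id.cpow_const hslit).differentiableWithinAt
  · have h := hFb _ (hre ξ hξ)
    have hn : 0 < ‖ξ‖ := norm_pos_iff.2 hξ.1
    have hpow : (‖ξ‖ ^ (-(1 / γ'))) ^ (-γ') = ‖ξ‖ := by
      rw [← Real.rpow_mul hn.le, neg_mul_neg, one_div_mul_cancel hγ'.ne', Real.rpow_one]
    simp only [hτ, Complex.norm_cpow_real] at h
    rwa [Real.mul_rpow hD.le (by positivity), hpow, ← mul_assoc] at h

end Sector

/-- Lemma 2.3.2 analogue: estimates for the derivatives of the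
optimal flat functions `G_a` and of `1/G_a`. -/
theorem flat_function_derivative_estimates
    (ω : ℝ → ℝ) (hω : InW0 ω) (h1 : Omega1 ω) (h5 : Omega5 ω)
    (hγι : 0 < gammaIndex (upperConjIota ω))
    (γ : ℝ) (hγ0 : 0 < γ)
    (hγ : ENNReal.ofReal γ < min 2 (gammaIndex (upperConjIota ω))) :
    ∃ G : ℝ → ℂ → ℂ, ∃ K₁ K₂ K₃ : ℝ, 0 < K₁ ∧ 0 < K₂ ∧ 0 < K₃ ∧
      (∀ a : ℝ, 0 < a →
        DifferentiableOn ℂ (G a) (sector γ) ∧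
        ∀ ξ ∈ sector γ, G a ξ ≠ 0 ∧
          K₁ ^ (-a) * Real.exp (-(2 * a) * upperConj ω (K₂ * ‖ξ‖)) ≤ ‖G a ξ‖ ∧
          ‖G a ξ‖ ≤ Real.exp (-(a / 2) * upperConj ω (K₃ * ‖ξ‖))) ∧
      (∀ a : ℝ, 0 < a → ∃ E₁ E₂ : ℝ, 0 < E₁ ∧ 0 < E₂ ∧
        ∀ ξ ∈ sector γ, ∀ j : ℕ,
          ‖iteratedDeriv j (G a) ξ‖ ≤
            E₁ ^ (j + 1) * Wseq ω (4 / a) j * hFun (wseq ω (4 / a)) (E₂ * ‖ξ‖)) ∧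
      (∀ y : ℝ, 0 < y → ∃ x a : ℝ, 0 < x ∧ 0 < a ∧
        ∃ E₃ E₄ E₅ : ℝ, 0 < E₃ ∧ 0 < E₄ ∧ 0 < E₅ ∧
        ∀ ξ ∈ sector γ, ∀ j : ℕ,
          ‖iteratedDeriv j (fun z => (G a z)⁻¹) ξ‖ ≤
            E₃ * E₄ ^ j * Wseq ω x j / hFun (wseq ω y) (E₅ * ‖ξ‖)) := by
  have hmin := lt_min_iff.1 hγ
  have hγ2 : γ < 2 := by
    have h := hmin.1
    rwa [← ENNReal.ofReal_ofNat 2, ENNReal.ofReal_lt_ofReal_iff two_pos] at h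
  obtain ⟨γ', ⟨hγ'0, hP⟩, hγγ'⟩ : ∃ γ', (0 < γ' ∧ Pcond (upperConjIota ω) γ') ∧ γ < γ' := by
    obtain ⟨γ', h⟩ := lt_iSup_iff.1 hmin.2
    obtain ⟨hP, h⟩ := lt_iSup_iff.1 h
    exact ⟨γ', hP, (ENNReal.ofReal_lt_ofReal_iff hP.1).1 h⟩
  obtain ⟨ε, hε0, hε1, hball⟩ :=
    exists_closedBall_subset_sector_s6 (lt_min hγγ' hγ2) (min_le_right γ' 2)
  obtain ⟨F, A, B, C, hA, hB, hC, hF, hFb⟩ := exists_holomorphic_re_comparable_upperConj hω h5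
    hγ'0 hP (min_le_left γ' 2) (min_le_right γ' 2)
  have hsub : sector γ ⊆ sector (min γ' 2) := fun ξ hξ =>
    hball ξ hξ (Metric.mem_closedBall_self (by positivity))
  set G : ℝ → ℂ → ℂ := fun a ξ => Complex.exp (-(a : ℂ) * F ξ) with hG
  have hGd : ∀ a, DifferentiableOn ℂ (G a) (sector (min γ' 2)) := fun a =>
    (hF.const_mul (-(a : ℂ))).cexp
  have hGn : ∀ a ξ, ‖G a ξ‖ = Real.exp (-a * (F ξ).re) := fun a ξ => by
    rw [hG, Complex.norm_exp, ← Complex.ofReal_neg, Complex.re_ofReal_mul]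
  refine ⟨G, Real.exp C, B, A, Real.exp_pos _, hB, hA, fun a ha => ⟨(hGd a).mono hsub,
    fun ξ hξ => ⟨Complex.exp_ne_zero _, ?_, ?_⟩⟩, fun a ha => ?_, fun y hy => ?_⟩
  · rw [hGn, ← Real.exp_mul, ← Real.exp_add, Real.exp_le_exp]
    have := mul_le_mul_of_nonneg_left (hFb ξ (hsub hξ)).2 ha.le
    linarith
  · rw [hGn, Real.exp_le_exp]
    have := mul_le_mul_of_nonneg_left (hFb ξ (hsub hξ)).1 ha.le
    linarith
  · set c := A * (1 + ε) with hc
    have hc0 : 0 < c := by positivity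
    have hl : 0 < 4 / a := by positivity
    refine ⟨Real.exp (c / (4 / a)) / ε, Real.exp (c / (4 / a)), by positivity, by positivity,
      fun ξ hξ j => ?_⟩
    have hn : 0 < ‖ξ‖ := norm_pos_iff.2 hξ.1
    have hM := norm_iteratedDeriv_le_of_sector hε0 hball (hGd a) hξ
      (M := Real.exp (-(1 / (4 / a)) * upperConj ω (c * ‖ξ‖)) *
        Real.exp (-(1 / (4 / a)) * upperConj ω (c * ‖ξ‖))) (fun z hz _ hz2 => ?_) j
    · refine hM.trans ?_
      have h1 := factorial_div_pow_mul_exp_le_Wseq hω h5 hl hc0 hn j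
      have h2 := exp_neg_upperConj_le_hFun hω h5 hl hc0 hn
      have h3 : 1 ≤ Real.exp (c / (4 / a)) / ε :=
        (one_le_div hε0).2 (hε1.le.trans (Real.one_le_exp (by positivity)))
      have hW := Wseq_pos (ω := ω) (4 / a) j
      have hh := hFun_wseq_pos hω h5 hl (mul_pos (Real.exp_pos (c / (4 / a))) hn)
      calc _ = (1 / ε) ^ j * (((j.factorial : ℝ) / ‖ξ‖ ^ j *
            Real.exp (-(1 / (4 / a)) * upperConj ω (c * ‖ξ‖))) *
            Real.exp (-(1 / (4 / a)) * upperConj ω (c * ‖ξ‖))) := by ring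
        _ ≤ (1 / ε) ^ j * ((Real.exp (c / (4 / a)) ^ j * Wseq ω (4 / a) j) *
            hFun (wseq ω (4 / a)) (Real.exp (c / (4 / a)) * ‖ξ‖)) := by gcongr
        _ = (Real.exp (c / (4 / a)) / ε) ^ j * Wseq ω (4 / a) j *
            hFun (wseq ω (4 / a)) (Real.exp (c / (4 / a)) * ‖ξ‖) := by
          rw [div_pow, div_pow, one_pow]
          ring
        _ ≤ _ := by
          gcongr
          omega
    · have hz0 : 0 < ‖z‖ := norm_pos_iff.2 hz.1
      rw [hGn, ← Real.exp_add, Real.exp_le_exp]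
      have h1 := mul_le_mul_of_nonneg_left (hFb z hz).1 ha.le
      have h2 : upperConj ω (c * ‖ξ‖) ≤ upperConj ω (A * ‖z‖) := by
        refine upperConj_anti hω h5 (by positivity) ?_
        rw [hc, mul_assoc]
        gcongr
      have h3 := mul_le_mul_of_nonneg_left h2 ha.le
      rw [one_div_div]
      linarith
  · obtain ⟨Cy, By, hCy, hBy, hhb⟩ := hFun_wseq_le_exp_neg_upperConj hω h5 hy
    set a := 1 / (8 * y) with ha
    have ha0 : 0 < a := by positivity
    set c := B * (1 - ε) with hc
    have hc0 : 0 < c := mul_pos hB (by linarith)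
    have hx : 0 < 4 * y := by positivity
    refine ⟨4 * y, a, hx, ha0, Real.exp (a * C) * Cy, Real.exp (c / (4 * y)) / ε, c / By,
      by positivity, by positivity, by positivity, fun ξ hξ j => ?_⟩
    have hn : 0 < ‖ξ‖ := norm_pos_iff.2 hξ.1
    have hinv : DifferentiableOn ℂ (fun z => (G a z)⁻¹) (sector (min γ' 2)) :=
      (hGd a).fun_inv fun _ _ => Complex.exp_ne_zero _
    set U := upperConj ω (c * ‖ξ‖) with hU
    have hM := norm_iteratedDeriv_le_of_sector hε0 hball hinv hξ
      (M := Real.exp (a * C) * (Real.exp (-(1 / (4 * y)) * U) * Real.exp (1 / (2 * y) * U)))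
      (fun z hz hz1 _ => ?_) j
    · refine hM.trans ?_
      have h1 := factorial_div_pow_mul_exp_le_Wseq hω h5 hx hc0 hn j
      have hh := hFun_wseq_pos hω h5 hy (by positivity : 0 < c / By * ‖ξ‖)
      have h2 := hhb (c / By * ‖ξ‖) (by positivity)
      have hcB : By * (c / By * ‖ξ‖) = c * ‖ξ‖ := by field_simp
      rw [hcB, ← hU] at h2
      have h3 : Real.exp (1 / (2 * y) * U) ≤ Cy / hFun (wseq ω y) (c / By * ‖ξ‖) := by
        rw [le_div_iff₀ hh]
        calc _ ≤ Real.exp (1 / (2 * y) * U) * (Cy * Real.exp (-(1 / (2 * y)) * U)) := by gcongr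
          _ = Cy * Real.exp (1 / (2 * y) * U + -(1 / (2 * y)) * U) := by
            rw [Real.exp_add]
            ring
          _ = Cy := by rw [neg_mul, add_neg_cancel, Real.exp_zero, mul_one]
      have hW := Wseq_pos (ω := ω) (4 * y) j
      calc _ = Real.exp (a * C) * (1 / ε) ^ j * (((j.factorial : ℝ) / ‖ξ‖ ^ j *
            Real.exp (-(1 / (4 * y)) * U)) * Real.exp (1 / (2 * y) * U)) := by ring
        _ ≤ Real.exp (a * C) * (1 / ε) ^ j * ((Real.exp (c / (4 * y)) ^ j * Wseq ω (4 * y) j) *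
            (Cy / hFun (wseq ω y) (c / By * ‖ξ‖))) := by gcongr
        _ = _ := by
          rw [div_pow, div_pow, one_pow]
          ring
    · have hz0 : 0 < ‖z‖ := norm_pos_iff.2 hz.1
      rw [norm_inv, hGn, ← Real.exp_neg, ← Real.exp_add, ← Real.exp_add, Real.exp_le_exp]
      have h1 := mul_le_mul_of_nonneg_left (hFb z hz).2 ha0.le
      have h2 : upperConj ω (B * ‖z‖) ≤ U := by
        refine upperConj_anti hω h5 (by positivity) ?_
        rw [hc, mul_assoc]
        gcongr
      have h3 := mul_le_mul_of_nonneg_left h2 ha0.le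
      have h4 : -(1 / (4 * y)) * U + 1 / (2 * y) * U = 2 * (a * U) := by
        rw [ha]
        field_simp
        ring
      rw [h4]
      linarith
end
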